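/- arXiv:1407.2664 — 3 statements merged into one kernel-verified Lean document; each statement's English description precedes it below -/
import Mathlib

section
/- Let T be a simple Λ-module. Then the following are equivalent: (i) there are, up to isomorphism, only finitely many finite-dimensional Λ-modules with top isomorphic to T; (ii) whenever M and N are finite-dimensional Λ-modules with top isomorphic to T such that J^l M/J^{l+1} M ≅ J^l N/J^{l+1} N for all l ≥ 0, then M ≅ N. -/
open Module

/-- The Jacobson radical `J` of the ring `Λ` (intersection of the maximal left ideals). -/
noncomputable def jacRad (Λ : Type) [Ring Λ] : Ideal Λ := Ideal.jacobson ⊥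

/-- The submodule `J • M` of a `Λ`-module `M`. -/
noncomputable def jrad (Λ : Type) [Ring Λ] (M : Type) [AddCommGroup M] [Module Λ M] :
    Submodule Λ M :=
  Submodule.span Λ {x : M | ∃ a ∈ jacRad Λ, ∃ m : M, a • m = x}


/-- The chain of submodules `J^l • M` of a `Λ`-module `M`. -/
noncomputable def radPow (Λ : Type) [Ring Λ] (M : Type) [AddCommGroup M] [Module Λ M] :
    ℕ → Submodule Λ M
  | 0 => ⊤
  | l + 1 => Submodule.span Λ {x : M | ∃ a ∈ jacRad Λ, ∃ m ∈ radPow Λ M l, a • m = x}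

/-- The `l`-th radical layer `J^l M / J^{l+1} M` of a `Λ`-module `M`. -/
noncomputable abbrev radLayer (Λ : Type) [Ring Λ] (M : Type) [AddCommGroup M] [Module Λ M]
    (l : ℕ) : Type :=
  ↥(radPow Λ M l) ⧸ (Submodule.comap (radPow Λ M l).subtype (radPow Λ M (l + 1)))

/-- `M` is a finite-dimensional module: finite-dimensionality over `K` is measured via the
`K`-vector space structure obtained by restricting scalars along `algebraMap K Λ`. -/
def FinDimMod (K : Type) [Field K] (Λ : Type) [Ring Λ] [Algebra K Λ]
    (M : Type) [AddCommGroup M] [Module Λ M] : Prop :=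
  letI : Module K M := Module.compHom M (algebraMap K Λ)
  FiniteDimensional K M


section basics

variable {Λ : Type} [Ring Λ] {M N : Type} [AddCommGroup M] [Module Λ M] [AddCommGroup N] [Module Λ N]

lemma jacRad_eq : jacRad Λ = Ring.jacobson Λ := Ideal.jacobson_bot

lemma jacRad_mul_right {a : Λ} (ha : a ∈ jacRad Λ) (b : Λ) : a * b ∈ jacRad Λ := by
  rw [jacRad_eq] at *
  exact Ideal.mul_mem_right _ _ ha

lemma smul_mem_radPow {a : Λ} (ha : a ∈ jacRad Λ) {l : ℕ} {m : M} (hm : m ∈ radPow Λ M l) :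
    a • m ∈ radPow Λ M (l + 1) := Submodule.subset_span ⟨a, ha, m, hm, rfl⟩

lemma radPow_succ_le_iff {l : ℕ} {S : Submodule Λ M} :
    radPow Λ M (l + 1) ≤ S ↔ ∀ a ∈ jacRad Λ, ∀ m ∈ radPow Λ M l, a • m ∈ S := by
  rw [radPow, Submodule.span_le]
  constructor
  · intro h a ha m hm
    exact h ⟨a, ha, m, hm, rfl⟩
  · rintro h _ ⟨a, ha, m, hm, rfl⟩
    exact h a ha m hm

lemma radPow_succ_le (l : ℕ) : radPow Λ M (l + 1) ≤ radPow Λ M l :=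
  radPow_succ_le_iff.2 fun _ _ _ hm => Submodule.smul_mem _ _ hm

lemma radPow_anti {k l : ℕ} (h : k ≤ l) : radPow Λ M l ≤ radPow Λ M k :=
  antitone_nat_of_succ_le (f := radPow Λ M) radPow_succ_le h

lemma radPow_one : radPow Λ M 1 = jrad Λ M := by
  simp [radPow, jrad]

lemma radPow_map (f : M →ₗ[Λ] N) (hf : Function.Surjective f) (l : ℕ) :
    (radPow Λ M l).map f = radPow Λ N l := by
  induction l with
  | zero => simp [radPow, LinearMap.range_eq_top.2 hf]
  | succ l ih =>
    apply le_antisymm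
    · rw [Submodule.map_le_iff_le_comap, radPow_succ_le_iff]
      intro a ha m hm
      rw [Submodule.mem_comap, map_smul]
      exact smul_mem_radPow ha (ih ▸ Submodule.mem_map_of_mem hm)
    · rw [radPow_succ_le_iff]
      intro a ha m hm
      rw [← ih] at hm
      obtain ⟨x, hx, rfl⟩ := hm
      exact ⟨a • x, smul_mem_radPow ha hx, map_smul _ _ _⟩

lemma radPow_self_one : radPow Λ Λ 1 = jacRad Λ := by
  apply le_antisymm
  · rw [radPow_succ_le_iff]
    intro a ha m _
    exact jacRad_mul_right ha m
  · intro a ha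
    have := smul_mem_radPow (M := Λ) (l := 0) (m := 1) ha trivial
    simpa using this

lemma radPow_self_mul {l : ℕ} {x j : Λ} (hx : x ∈ radPow Λ Λ l) (hj : j ∈ jacRad Λ) :
    x * j ∈ radPow Λ Λ (l + 1) := by
  induction l generalizing x with
  | zero =>
    rw [zero_add, radPow_self_one]
    exact Ideal.mul_mem_left _ _ hj
  | succ l ih =>
    have : radPow Λ Λ (l + 1) ≤ (radPow Λ Λ (l + 2)).comap (LinearMap.toSpanSingleton Λ Λ j) := by
      rw [radPow_succ_le_iff]
      intro a ha m hm
      have := smul_mem_radPow ha (ih hm)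
      simpa [mul_assoc] using this
    simpa using this hx

lemma exists_radPow_eq_bot [IsArtinianRing Λ] (M : Type) [AddCommGroup M] [Module Λ M] :
    ∃ L, ∀ l, L ≤ l → radPow Λ M l = ⊥ := by
  obtain ⟨n, hn⟩ := IsArtinianRing.isNilpotent_jacobson_bot (R := Λ)
  refine ⟨n, fun l hl => ?_⟩
  have key : ∀ k, radPow Λ M k ≤ (jacRad Λ) ^ k • (⊤ : Submodule Λ M) := by
    intro k
    induction k with
    | zero => rw [Submodule.pow_zero, Ideal.one_eq_top, Submodule.top_smul]; exact le_top
    | succ k ih =>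
      rw [radPow_succ_le_iff]
      intro a ha m hm
      have : (jacRad Λ).IsTwoSided := by rw [jacRad_eq]; infer_instance
      rw [Ideal.IsTwoSided.pow_succ, Submodule.mul_smul]
      exact Submodule.smul_mem_smul ha (ih hm)
  rw [eq_bot_iff]
  refine (radPow_anti hl).trans ((key n).trans ?_)
  have : jacRad Λ ^ n = ⊥ := hn
  rw [this, Submodule.bot_smul]

lemma nakayama [IsArtinianRing Λ] (S : Submodule Λ M) (h : S ⊔ radPow Λ M 1 = ⊤) : S = ⊤ := by
  obtain ⟨L, hL⟩ := exists_radPow_eq_bot (Λ := Λ) M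
  have key : ∀ k, S ⊔ radPow Λ M k = ⊤ := by
    intro k
    induction k with
    | zero => simp [radPow]
    | succ k ih =>
      have h1 : radPow Λ M 1 ≤ S ⊔ radPow Λ M (k + 1) := by
        rw [radPow_succ_le_iff]
        intro a ha m _
        have hm : m ∈ S ⊔ radPow Λ M k := ih ▸ trivial
        obtain ⟨s, hs, r, hr, rfl⟩ := Submodule.mem_sup.1 hm
        rw [smul_add]
        exact Submodule.add_mem_sup (S.smul_mem _ hs) (smul_mem_radPow ha hr)
      rw [eq_top_iff, ← h]
      exact sup_le le_sup_left h1
  simpa [hL L le_rfl] using key L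

lemma isUnit_one_add [IsArtinianRing Λ] {j : Λ} (hj : j ∈ jacRad Λ) : IsUnit (1 + j) := by
  obtain ⟨n, hn⟩ := IsArtinianRing.isNilpotent_jacobson_bot (R := Λ)
  apply IsNilpotent.isUnit_one_add
  refine ⟨n, ?_⟩
  have := Ideal.pow_mem_pow hj n
  rw [show jacRad Λ ^ n = ⊥ from hn] at this
  simpa using this

/-- iso of quotients by left ideals from right multiplication -/
lemma iso_of_conj [IsArtinianRing Λ] {C C' : Submodule Λ Λ} {j : Λ} (hj : j ∈ jacRad Λ)
    (h : ∀ x, x ∈ C ↔ x * (1 + j) ∈ C') : Nonempty ((Λ ⧸ C) ≃ₗ[Λ] (Λ ⧸ C')) := by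
  obtain ⟨u, hu⟩ := isUnit_one_add hj
  let f : Λ ≃ₗ[Λ] Λ := 
    { toFun := fun x => x * u
      invFun := fun x => x * ↑u⁻¹
      map_add' := fun x y => add_mul _ _ _
      map_smul' := fun a x => by simp [mul_assoc]
      left_inv := fun x => by simp [mul_assoc]
      right_inv := fun x => by simp [mul_assoc] }
  refine ⟨Submodule.Quotient.equiv C C' f ?_⟩
  ext x
  constructor
  · rintro ⟨y, hy, rfl⟩
    have := (h y).1 hy
    rwa [← hu] at this
  · intro hx
    refine ⟨x * ↑u⁻¹, (h _).2 ?_, ?_⟩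
    · rw [← hu]; simpa [mul_assoc] using hx
    · simp [f, mul_assoc]

lemma semisimple_of_jac [IsArtinianRing Λ] (h : ∀ a ∈ jacRad Λ, ∀ m : M, a • m = 0) :
    IsSemisimpleModule Λ M := by
  have h' : Module.IsTorsionBySet Λ M (Ring.jacobson Λ) := by
    rintro m ⟨a, ha⟩
    rw [← jacRad_eq] at ha
    exact h a ha m
  let _ := h'.module
  exact (h'.semilinearMap.isSemisimpleModule_iff_of_bijective Function.bijective_id).2
      inferInstance

/-- finitely many quotients of a noetherian semisimple module -/
lemma finite_quotients [IsSemisimpleModule Λ M] [IsNoetherian Λ M] :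
    ∃ (n : ℕ) (S : Fin n → Submodule Λ M), ∀ C : Submodule Λ M,
      ∃ i, Nonempty ((M ⧸ C) ≃ₗ[Λ] S i) := by
  classical
  obtain ⟨s, hs⟩ : ∃ s : Finset (Submodule Λ M), (∀ a ∈ s, IsAtom a) ∧ s.sup id = ⊤ := by
    have h1 : sSup {m : Submodule Λ M | IsSimpleModule Λ m} = ⊤ :=
      IsSemisimpleModule.sSup_simples_eq_top Λ M
    have h2 := (CompleteLattice.WellFoundedGT.isSupFiniteCompact (Submodule Λ M))
      {m : Submodule Λ M | IsSimpleModule Λ m}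
    obtain ⟨t, ht, ht2⟩ := h2
    exact ⟨t, fun a ha => isSimpleModule_iff_isAtom.1 (ht ha), by rw [← ht2, h1]⟩
  have e := s.powerset.equivFin
  refine ⟨_, fun i => (e.symm i).1.sup id, fun C => ?_⟩
  let P : Finset (Finset (Submodule Λ M)) := s.powerset.filter fun t => Disjoint C (t.sup id)
  have hP : P.Nonempty := ⟨∅, by simp [P]⟩
  obtain ⟨t, htP, hmax⟩ := P.exists_max_image Finset.card hP
  have ht : t ⊆ s ∧ Disjoint C (t.sup id) := by simpa [P] using htP
  have hc : C ⊔ t.sup id = ⊤ := by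
    rw [eq_top_iff, ← hs.2]
    apply Finset.sup_le
    intro a ha
    by_contra hna
    have hd : Disjoint (C ⊔ t.sup id) a := ((hs.1 a ha).not_le_iff_disjoint.1 hna).symm
    have hd2 : Disjoint C (t.sup id ⊔ a) := ht.2.disjoint_sup_right_of_disjoint_sup_left hd
    have hat : a ∉ t := fun h => hna (le_sup_of_le_right (Finset.le_sup (f := id) h))
    have := hmax (insert a t) (by
      simp only [P, Finset.mem_filter, Finset.mem_powerset]
      refine ⟨Finset.insert_subset ha ht.1, ?_⟩
      rw [Finset.sup_insert, sup_comm]; exact hd2)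
    rw [Finset.card_insert_of_notMem hat] at this
    omega
  refine ⟨e ⟨t, Finset.mem_powerset.2 ht.1⟩, ?_⟩
  have hst : (e.symm (e ⟨t, Finset.mem_powerset.2 ht.1⟩)).1 = t := by rw [e.symm_apply_apply]
  beta_reduce
  rw [hst]
  exact ⟨Submodule.quotientEquivOfIsCompl _ _ ⟨ht.2, codisjoint_iff.2 hc⟩⟩

end basics

section core

variable {K Λ : Type} [Field K] [Ring Λ] [Algebra K Λ] [FiniteDimensional K Λ]

lemma conj_of_iso [IsAlgClosed K] {I C C' : Submodule Λ Λ} (hI : IsSimpleModule Λ (Λ ⧸ I))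
    (hC' : C' ≤ I) (hIC : I ≤ C ⊔ jacRad Λ) (hIC' : I ≤ C' ⊔ jacRad Λ)
    (hJI : jacRad Λ ≤ I)
    (φ : (Λ ⧸ C) ≃ₗ[Λ] (Λ ⧸ C')) : ∃ j ∈ jacRad Λ, ∀ x ∈ C, x * (1 + j) ∈ C' := by
  obtain ⟨a, ha⟩ := Submodule.Quotient.mk_surjective C' (φ (Submodule.Quotient.mk 1))
  have hφ : ∀ x : Λ, φ (Submodule.Quotient.mk x) = Submodule.Quotient.mk (x * a) := by
    intro x
    have : (Submodule.Quotient.mk x : Λ ⧸ C) = x • Submodule.Quotient.mk 1 := by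
      rw [← Submodule.Quotient.mk_smul, smul_eq_mul, mul_one]
    rw [this, map_smul, ← ha, ← Submodule.Quotient.mk_smul, smul_eq_mul]
  have hCa : ∀ x ∈ C, x * a ∈ C' := by
    intro x hx
    rw [← Submodule.Quotient.mk_eq_zero, ← hφ, (Submodule.Quotient.mk_eq_zero C).2 hx, map_zero]
  have hIa : I ≤ I.comap (LinearMap.toSpanSingleton Λ Λ a) := by
    intro x hx
    obtain ⟨c, hc, j, hj, rfl⟩ := Submodule.mem_sup.1 (hIC hx)
    simp only [Submodule.mem_comap, LinearMap.toSpanSingleton_apply, smul_eq_mul, add_mul]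
    exact add_mem (hC' (hCa c hc)) (hJI (jacRad_mul_right hj a))
  let f : Module.End Λ (Λ ⧸ I) := I.mapQ I (LinearMap.toSpanSingleton Λ Λ a) hIa
  obtain ⟨c, hc⟩ := (IsSimpleModule.algebraMap_end_bijective_of_isAlgClosed (A := Λ)
    (V := Λ ⧸ I) K).2 f
  have hac : a - algebraMap K Λ c ∈ I := by
    have := LinearMap.congr_fun hc (Submodule.Quotient.mk 1)
    simp only [Module.algebraMap_end_apply, f, Submodule.mapQ_apply,
      LinearMap.toSpanSingleton_apply, one_smul, ← Submodule.Quotient.mk_smul] at this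
    rw [← Submodule.Quotient.eq, ← this, Algebra.algebraMap_eq_smul_one]
  have hIne : (1 : Λ) ∉ I := by
    intro h1
    have : I = ⊤ := (Ideal.eq_top_iff_one I).2 h1
    subst this
    have := hI.nontrivial
    exact not_subsingleton _ (inferInstance : Subsingleton (Λ ⧸ (⊤ : Submodule Λ Λ)))
  have hc0 : c ≠ 0 := by
    rintro rfl
    rw [map_zero, sub_zero] at hac
    obtain ⟨y, hy⟩ := φ.surjective (Submodule.Quotient.mk 1)
    obtain ⟨x, rfl⟩ := Submodule.Quotient.mk_surjective C y
    rw [hφ, Submodule.Quotient.eq] at hy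
    apply hIne
    have h2 := sub_mem (I.smul_mem x hac) (hC' hy)
    simpa using h2
  obtain ⟨c', hc', j, hj, hcj⟩ := Submodule.mem_sup.1
    (hIC' (I.smul_mem (algebraMap K Λ c⁻¹) hac))
  refine ⟨j, hj, fun x hx => ?_⟩
  have e : 1 + j = algebraMap K Λ c⁻¹ * a - c' := by
    rw [smul_eq_mul, mul_sub, ← map_mul, inv_mul_cancel₀ hc0, map_one] at hcj
    have : j = algebraMap K Λ c⁻¹ * a - 1 - c' := by rw [← hcj]; abel
    rw [this]; abel
  rw [e, mul_sub]
  refine sub_mem ?_ (C'.smul_mem x hc')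
  rw [← mul_assoc, ← Algebra.commutes, mul_assoc]
  exact C'.smul_mem _ (hCa x hx)

lemma ker_eq_of_le {W Y : Type} [AddCommGroup W] [AddCommGroup Y] [Module K W] [Module K Y]
    [FiniteDimensional K W] (p q : W →ₗ[K] Y) (hp : Function.Surjective p)
    (h : ∀ w, q w = 0 → p w = 0) (w : W) (hw : p w = 0) : q w = 0 := by
  have : FiniteDimensional K Y := Module.Finite.of_surjective p hp
  have hle : LinearMap.ker q ≤ LinearMap.ker p := h
  have h1 := p.finrank_range_add_finrank_ker
  have h2 := q.finrank_range_add_finrank_ker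
  rw [LinearMap.range_eq_top.2 hp, finrank_top] at h1
  have h3 := Submodule.finrank_le (LinearMap.range q)
  have := Submodule.eq_of_le_of_finrank_le hle (by omega)
  have hw' : w ∈ LinearMap.ker q := this ▸ hw
  exact hw'

variable {B W E : Submodule Λ Λ} {Y : Type} [AddCommGroup Y] [Module Λ Y] [Module K Y]
  [IsScalarTower K Λ Y]

lemma claim1 [Infinite K] (hEW : E ≤ W) (hWB : W ≤ B)
    (X : Submodule Λ Λ) (hXB : X ≤ B) (hEX : E ≤ X) (hXW : B ≤ X ⊔ W) (hXWE : X ⊓ W ≤ E)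
    (p p' : B →ₗ[Λ] Y)
    (hp : ∀ y, ∃ w, ∃ h : w ∈ W, p ⟨w, hWB h⟩ = y)
    (hp' : ∀ y, ∃ w, ∃ h : w ∈ W, p' ⟨w, hWB h⟩ = y)
    (hpE : ∀ w (h : w ∈ E), p ⟨w, hWB (hEW h)⟩ = 0)
    (hpE' : ∀ w (h : w ∈ E), p' ⟨w, hWB (hEW h)⟩ = 0)
    (hfin : ∀ F : K → Submodule Λ Λ, (∀ k, F k ≤ B ∧ E ≤ F k ∧ B ≤ F k ⊔ W) →
      ∃ k l, k ≠ l ∧ ∃ j ∈ jacRad Λ, (∀ b ∈ B, b * j ∈ B) ∧ (∀ w ∈ W, w * j ∈ E) ∧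
        ∀ x ∈ F k, x * (1 + j) ∈ F l) :
    ∀ w (h : w ∈ W), p ⟨w, hWB h⟩ = 0 ↔ p' ⟨w, hWB h⟩ = 0 := by
  let i : W →ₗ[Λ] B := Submodule.inclusion hWB
  let q : K → W →ₗ[Λ] Y := fun k => p ∘ₗ i + k • (p' ∘ₗ i)
  let D : K → Submodule Λ Λ := fun k => (LinearMap.ker (q k)).map W.subtype
  have hDW : ∀ k, D k ≤ W := fun k => Submodule.map_subtype_le _ _
  have hD : ∀ k w (h : w ∈ W), w ∈ D k ↔ p ⟨w, hWB h⟩ + k • p' ⟨w, hWB h⟩ = 0 := by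
    intro k w h
    constructor
    · rintro ⟨⟨w', hw'⟩, h1, h2⟩
      simp only [Submodule.subtype_apply] at h2
      subst h2
      exact h1
    · intro h1
      exact ⟨⟨w, h⟩, h1, rfl⟩
  have hED : ∀ k, E ≤ D k := by
    intro k w hw
    rw [hD k w (hEW hw), hpE w hw, hpE' w hw, smul_zero, add_zero]
  obtain ⟨k, l, hkl, j, hj, hBj, hWj, hF⟩ := hfin (fun k => X ⊔ D k) (fun k =>
    ⟨sup_le hXB ((hDW k).trans hWB), hEX.trans le_sup_left,
      hXW.trans (sup_le_sup_right le_sup_left _)⟩)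
  have hkey : ∀ w ∈ D k, w ∈ D l := by
    intro w hw
    have h1 := hF w (Submodule.mem_sup_right hw)
    rw [mul_add, mul_one] at h1
    have h2 : w ∈ X ⊔ D l := by
      have := sub_mem h1 (Submodule.mem_sup_left (hEX (hWj w (hDW k hw))) : w * j ∈ X ⊔ D l)
      simpa using this
    obtain ⟨x, hx, d, hd, rfl⟩ := Submodule.mem_sup.1 h2
    have hxW : x ∈ W := by
      have := sub_mem (hDW k hw) (hDW l hd)
      simpa using this
    exact add_mem (hED l (hXWE ⟨hx, hxW⟩)) hd
  have hz : ∀ w (h : w ∈ W), w ∈ D k → p ⟨w, hWB h⟩ = 0 ∧ p' ⟨w, hWB h⟩ = 0 := by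
    intro w h hw
    have h1 := (hD k w h).1 hw
    have h2 := (hD l w h).1 (hkey w hw)
    have h3 : (k - l) • p' ⟨w, hWB h⟩ = 0 := by
      rw [sub_smul, sub_eq_zero]
      exact add_left_cancel (h1.trans h2.symm)
    have h4 := (smul_eq_zero.1 h3).resolve_left (sub_ne_zero.2 hkl)
    rw [h4, smul_zero, add_zero] at h1
    exact ⟨h1, h4⟩
  have fW : FiniteDimensional K W := 
    inferInstanceAs (FiniteDimensional K (W.restrictScalars K))
  have hqD : ∀ w : W, q k w = 0 → (w : Λ) ∈ D k := fun w hw => ⟨w, hw, rfl⟩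
  intro w h
  constructor
  · intro h0
    have := ker_eq_of_le ((p ∘ₗ i).restrictScalars K) ((q k).restrictScalars K)
      (fun y => by obtain ⟨w, h, e⟩ := hp y; exact ⟨⟨w, h⟩, e⟩)
      (fun w hw => (hz w w.2 (hqD w hw)).1) ⟨w, h⟩ h0
    exact (hz w h (hqD ⟨w, h⟩ this)).2
  · intro h0
    have := ker_eq_of_le ((p' ∘ₗ i).restrictScalars K) ((q k).restrictScalars K)
      (fun y => by obtain ⟨w, h, e⟩ := hp' y; exact ⟨⟨w, h⟩, e⟩)
      (fun w hw => (hz w w.2 (hqD w hw)).2) ⟨w, h⟩ h0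
    exact (hz w h (hqD ⟨w, h⟩ this)).1

/-- right multiplication by `n` on a left ideal `B` -/
def rho (n : Λ) (hn : ∀ b ∈ B, b * n ∈ B) : B →ₗ[Λ] B :=
  (LinearMap.toSpanSingleton Λ Λ n).restrict (p := B) (q := B) hn

lemma rho_coe (n : Λ) (hn : ∀ b ∈ B, b * n ∈ B) (b : B) : (rho n hn b : Λ) = b * n := rfl

lemma claim2 (hEW : E ≤ W) (hWB : W ≤ B)
    (p p' : B →ₗ[Λ] Y)
    (hp : ∀ y, ∃ w, ∃ h : w ∈ W, p ⟨w, hWB h⟩ = y)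
    (hpE : ∀ w (h : w ∈ E), p ⟨w, hWB (hEW h)⟩ = 0)
    (hWN : ∀ j ∈ jacRad Λ, (∀ b ∈ B, b * j ∈ B) → ∀ w ∈ W, w * j ∈ E)
    (hpp' : ∀ w (h : w ∈ W), p ⟨w, hWB h⟩ = p' ⟨w, hWB h⟩)
    (hfin : ∀ F : K → Submodule Λ Λ, (∀ k, F k ≤ B ∧ E ≤ F k ∧ B ≤ F k ⊔ W) →
      ∃ k l, k ≠ l ∧ ∃ j ∈ jacRad Λ, (∀ b ∈ B, b * j ∈ B) ∧ (∀ w ∈ W, w * j ∈ E) ∧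
        ∀ x ∈ F k, x * (1 + j) ∈ F l) :
    ∃ n ∈ jacRad Λ, ∃ hn : ∀ b ∈ B, b * n ∈ B, ∀ b, p' b = p b + p (rho n hn b) := by
  let Δ : (B →ₗ[Λ] Y) → Prop := fun h => ∃ n ∈ jacRad Λ, ∃ hn : ∀ b ∈ B, b * n ∈ B,
    ∀ b, h b = p (rho n hn b)
  have base : ∀ h : B →ₗ[Λ] Y, (∀ w (hw : w ∈ W), h ⟨w, hWB hw⟩ = 0) →
      (∀ a ∈ jacRad Λ, ∀ ha : ∀ b ∈ B, b * a ∈ B, Δ (h ∘ₗ rho a ha)) → Δ h := by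
    intro h hW hΔ
    let q : K → B →ₗ[Λ] Y := fun k => p + k • h
    have hq : ∀ k b, q k b = p b + k • h b := fun _ _ => rfl
    let F : K → Submodule Λ Λ := fun k => (LinearMap.ker (q k)).map B.subtype
    have hF : ∀ k w (hw : w ∈ B), w ∈ F k ↔ q k ⟨w, hw⟩ = 0 := by
      intro k w hw
      constructor
      · rintro ⟨⟨w', hw'⟩, h1, h2⟩
        simp only [Submodule.subtype_apply] at h2
        subst h2
        exact h1
      · intro h1
        exact ⟨⟨w, hw⟩, h1, rfl⟩
    have hqW : ∀ k w (hw : w ∈ W), q k ⟨w, hWB hw⟩ = p ⟨w, hWB hw⟩ := by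
      intro k w hw
      rw [hq, hW w hw, smul_zero, add_zero]
    have hdec : ∀ k (b : B), ∃ w, ∃ hw : w ∈ W, (b : Λ) - w ∈ F k ∧ p ⟨w, hWB hw⟩ = q k b := by
      intro k b
      obtain ⟨w, hw, e⟩ := hp (q k b)
      refine ⟨w, hw, (hF k _ (sub_mem b.2 (hWB hw))).2 ?_, e⟩
      have : (⟨b - w, sub_mem b.2 (hWB hw)⟩ : B) = b - ⟨w, hWB hw⟩ := rfl
      rw [this, map_sub, hqW k w hw, e, sub_self]
    obtain ⟨k, l, hkl, j, hj, hBj, hWj, hFj⟩ := hfin F (by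
      intro k
      refine ⟨Submodule.map_subtype_le _ _, ?_, ?_⟩
      · intro e he
        rw [hF k e (hWB (hEW he)), hqW k e (hEW he), hpE e he]
      · intro b hb
        obtain ⟨w, hw, h1, -⟩ := hdec k ⟨b, hb⟩
        have := Submodule.add_mem_sup h1 hw
        simpa using this)
    have hmain : ∀ b : B, (k - l) • h b = p (rho j hBj b) + l • h (rho j hBj b) := by
      intro b
      obtain ⟨w, hw, h1, h2⟩ := hdec k b
      have h3 := hFj _ h1
      have hc : q l (b - ⟨w, hWB hw⟩ + rho j hBj (b - ⟨w, hWB hw⟩)) = 0 := by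
        rw [← (hF l _ (Subtype.property _))]
        have : ((b - ⟨w, hWB hw⟩ + rho j hBj (b - ⟨w, hWB hw⟩) : B) : Λ)
          = ((b : Λ) - w) * (1 + j) := by
          rw [Submodule.coe_add, rho_coe, mul_add, mul_one]; rfl
        rw [this]; exact h3
      have hwj : q l (rho j hBj ⟨w, hWB hw⟩) = 0 := by
        have := hqW l (w * j) (hEW (hWj w hw))
        rw [hpE _ (hWj w hw)] at this
        exact this
      rw [map_add, map_sub, map_sub, map_sub, hwj, hqW l w hw, h2, hq, hq, hq, sub_zero] at hc
      rw [sub_smul, sub_eq_iff_eq_add, ← sub_eq_zero, ← neg_eq_zero, ← hc]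
      abel
    obtain ⟨n, hn, hBn, hhn⟩ := hΔ j hj hBj
    have hJ : (k - l)⁻¹ • (j + l • n) ∈ jacRad Λ :=
      Submodule.smul_of_tower_mem _ _ (add_mem hj (Submodule.smul_of_tower_mem _ _ hn))
    refine ⟨(k - l)⁻¹ • (j + l • n), hJ, fun b hb => ?_, fun b => ?_⟩
    · rw [mul_smul_comm, mul_add, mul_smul_comm]
      exact Submodule.smul_of_tower_mem _ _ (add_mem (hBj b hb)
        (Submodule.smul_of_tower_mem _ _ (hBn b hb)))
    · have h1 := hmain b
      have h2 := hhn b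
      rw [LinearMap.comp_apply] at h2
      rw [h2] at h1
      have h3 : h b = (k - l)⁻¹ • (p (rho j hBj b) + l • p (rho n hBn b)) := by
        rw [← h1, smul_smul, inv_mul_cancel₀ (sub_ne_zero.2 hkl), one_smul]
      have hps : ∀ (c : K) (b : B), p (c • b) = c • p b :=
        fun c b => (p.restrictScalars K).map_smul c b
      rw [h3, ← hps, ← map_add, ← hps]
      congr 1
      apply Subtype.ext
      rw [rho_coe]
      simp [rho_coe, mul_add]
  have ind : ∀ k, ∀ h : B →ₗ[Λ] Y, (∀ w (hw : w ∈ W), h ⟨w, hWB hw⟩ = 0) →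
      (∀ a ∈ jacRad Λ, a ∈ radPow Λ Λ k → ∀ ha : ∀ b ∈ B, b * a ∈ B, Δ (h ∘ₗ rho a ha)) →
        Δ h := by
    intro k
    induction k with
    | zero => exact fun h hW hΔ => base h hW fun a ha => hΔ a ha trivial
    | succ k ih =>
      intro h hW hΔ
      apply ih h hW
      intro n hn hnk hBn
      apply base
      · intro w hw
        exact hW (w * n) (hEW (hWN n hn hBn w hw))
      · intro a ha hBa
        obtain ⟨m, hm, hBm, e⟩ := hΔ (a * n) (jacRad_mul_right ha n) (smul_mem_radPow ha hnk)
          (fun b hb => by rw [← mul_assoc]; exact hBn _ (hBa b hb))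
        refine ⟨m, hm, hBm, fun b => ?_⟩
        rw [← e b]
        simp only [LinearMap.comp_apply]
        congr 1
        apply Subtype.ext
        simp [rho_coe, mul_assoc]
  have art : IsArtinianRing Λ := IsArtinianRing.of_finite K Λ
  obtain ⟨L, hL⟩ := exists_radPow_eq_bot (Λ := Λ) Λ
  obtain ⟨n, hn, hBn, e⟩ := ind L (p' - p)
    (fun w hw => by rw [LinearMap.sub_apply, hpp' w hw, sub_self]) (by
      intro a _ ha hBa
      rw [hL L le_rfl] at ha
      have : a = 0 := by simpa using ha
      subst this
      refine ⟨0, zero_mem _, hBa, fun b => ?_⟩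
      have : rho 0 hBa b = 0 := Subtype.ext (by simp [rho_coe])
      rw [LinearMap.comp_apply, this, map_zero, map_zero])
  refine ⟨n, hn, hBn, fun b => ?_⟩
  rw [← e b, LinearMap.sub_apply]; abel

end core

section assembly

variable {K Λ : Type} [Field K] [Ring Λ] [Algebra K Λ] [FiniteDimensional K Λ]

lemma core {B W E : Submodule Λ Λ} {Y : Type} [AddCommGroup Y] [Module Λ Y] [Module K Y]
    [IsScalarTower K Λ Y] [Infinite K] (hEW : E ≤ W) (hWB : W ≤ B)
    (X : Submodule Λ Λ) (hXB : X ≤ B) (hEX : E ≤ X) (hXW : B ≤ X ⊔ W) (hXWE : X ⊓ W ≤ E)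
    (p p' : B →ₗ[Λ] Y)
    (hp : ∀ y, ∃ w, ∃ h : w ∈ W, p ⟨w, hWB h⟩ = y)
    (hp' : ∀ y, ∃ w, ∃ h : w ∈ W, p' ⟨w, hWB h⟩ = y)
    (hpE : ∀ w (h : w ∈ E), p ⟨w, hWB (hEW h)⟩ = 0)
    (hpE' : ∀ w (h : w ∈ E), p' ⟨w, hWB (hEW h)⟩ = 0)
    (hWN : ∀ j ∈ jacRad Λ, (∀ b ∈ B, b * j ∈ B) → ∀ w ∈ W, w * j ∈ E)
    (hfin : ∀ F : K → Submodule Λ Λ, (∀ k, F k ≤ B ∧ E ≤ F k ∧ B ≤ F k ⊔ W) →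
      ∃ k l, k ≠ l ∧ ∃ j ∈ jacRad Λ, (∀ b ∈ B, b * j ∈ B) ∧ (∀ w ∈ W, w * j ∈ E) ∧
        ∀ x ∈ F k, x * (1 + j) ∈ F l) :
    ∃ j ∈ jacRad Λ, ∀ x, (∃ h : x ∈ B, p' ⟨x, h⟩ = 0) ↔
      (∃ h : x * (1 + j) ∈ B, p ⟨x * (1 + j), h⟩ = 0) := by
  have art : IsArtinianRing Λ := IsArtinianRing.of_finite K Λ
  have c1 := claim1 hEW hWB X hXB hEX hXW hXWE p p' hp hp' hpE hpE' hfin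
  let i : W →ₗ[Λ] B := Submodule.inclusion hWB
  have s1 : Function.Surjective (p ∘ₗ i) := fun y => by
    obtain ⟨w, h, e⟩ := hp y; exact ⟨⟨w, h⟩, e⟩
  have s2 : Function.Surjective (p' ∘ₗ i) := fun y => by
    obtain ⟨w, h, e⟩ := hp' y; exact ⟨⟨w, h⟩, e⟩
  have hk : LinearMap.ker (p' ∘ₗ i) = LinearMap.ker (p ∘ₗ i) := by
    ext w
    exact (c1 w w.2).symm
  let σ : Y ≃ₗ[Λ] Y := ((p' ∘ₗ i).quotKerEquivOfSurjective s2).symm ≪≫ₗ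
    Submodule.quotEquivOfEq _ _ hk ≪≫ₗ (p ∘ₗ i).quotKerEquivOfSurjective s1
  have hσ : ∀ w : W, σ (p' (i w)) = p (i w) := by
    intro w
    have : ((p' ∘ₗ i).quotKerEquivOfSurjective s2).symm (p' (i w)) = Submodule.Quotient.mk w := by
      rw [LinearEquiv.symm_apply_eq]; rfl
    simp only [σ, LinearEquiv.trans_apply, this]
    rfl
  obtain ⟨n, hn, hBn, e⟩ := claim2 hEW hWB p (σ.toLinearMap ∘ₗ p') hp hpE hWN
    (fun w h => (hσ ⟨w, h⟩).symm) hfin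
  refine ⟨n, hn, fun x => ?_⟩
  have key : ∀ (x : Λ) (h : x ∈ B) (h' : x * (1 + n) ∈ B),
      p' ⟨x, h⟩ = 0 ↔ p ⟨x * (1 + n), h'⟩ = 0 := by
    intro x h h'
    have e1 := e ⟨x, h⟩
    rw [← map_add] at e1
    have e2 : (⟨x * (1 + n), h'⟩ : B) = ⟨x, h⟩ + rho n hBn ⟨x, h⟩ :=
      Subtype.ext (by change x * (1 + n) = x + x * n; rw [mul_add, mul_one])
    rw [e2, ← e1]
    simp
  have hB1 : ∀ x ∈ B, x * (1 + n) ∈ B := fun x hx => by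
    rw [mul_add, mul_one]; exact add_mem hx (hBn x hx)
  constructor
  · rintro ⟨h, h0⟩
    exact ⟨hB1 x h, (key x h _).1 h0⟩
  · rintro ⟨h, h0⟩
    have fB : FiniteDimensional K B := inferInstanceAs (FiniteDimensional K (B.restrictScalars K))
    have hinj : Function.Injective ((rho (1 + n) hB1).restrictScalars K) := by
      intro a b hab
      have h1 : (a : Λ) * (1 + n) = b * (1 + n) := congrArg Subtype.val hab
      exact Subtype.ext ((isUnit_one_add hn).mul_right_cancel h1)
    obtain ⟨b, hb⟩ := LinearMap.injective_iff_surjective.1 hinj ⟨x * (1 + n), h⟩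
    have h1 : (b : Λ) * (1 + n) = x * (1 + n) := congrArg Subtype.val hb
    have h2 : x ∈ B := (isUnit_one_add hn).mul_right_cancel h1 ▸ b.2
    exact ⟨h2, (key x h2 h).2 h0⟩

lemma finDim_iff (M : Type) [AddCommGroup M] [Module Λ M] :
    FinDimMod K Λ M ↔ Module.Finite Λ M := by
  let _ : Module K M := Module.compHom M (algebraMap K Λ)
  have : IsScalarTower K Λ M := IsScalarTower.of_algebraMap_smul fun _ _ => rfl
  change Module.Finite K M ↔ _
  exact ⟨fun _ => Module.Finite.of_restrictScalars_finite K Λ M, fun _ => Module.Finite.trans Λ M⟩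

end assembly

section assembly2

variable {Λ : Type} [Ring Λ] {M N : Type} [AddCommGroup M] [Module Λ M]
  [AddCommGroup N] [Module Λ N]

lemma quotComap (f : N →ₗ[Λ] M) (hf : Function.Surjective f) (S : Submodule Λ M)
    (S' : Submodule Λ N) (h : S' = S.comap f) : Nonempty ((N ⧸ S') ≃ₗ[Λ] (M ⧸ S)) := by
  have hs : Function.Surjective (S.mkQ ∘ₗ f) := (Submodule.mkQ_surjective S).comp hf
  have hk : S' = LinearMap.ker (S.mkQ ∘ₗ f) := by rw [LinearMap.ker_comp, Submodule.ker_mkQ, h]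
  exact ⟨Submodule.quotEquivOfEq _ _ hk ≪≫ₗ (S.mkQ ∘ₗ f).quotKerEquivOfSurjective hs⟩

lemma exists_complement [IsArtinianRing Λ] {B W E : Submodule Λ Λ} (hEB : E ≤ B)
    (hE : ∀ a ∈ jacRad Λ, ∀ b ∈ B, a * b ∈ E) :
    ∃ X : Submodule Λ Λ, X ≤ B ∧ E ≤ X ∧ B ≤ X ⊔ W ∧ X ⊓ W ≤ E := by
  let E' := E.comap B.subtype
  have ss : IsSemisimpleModule Λ (B ⧸ E') := by
    apply semisimple_of_jac
    intro a ha m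
    obtain ⟨b, rfl⟩ := Submodule.Quotient.mk_surjective _ m
    rw [← Submodule.Quotient.mk_smul, Submodule.Quotient.mk_eq_zero]
    exact hE a ha b b.2
  let W' := (W.comap B.subtype).map E'.mkQ
  obtain ⟨X', hX'⟩ := exists_isCompl W'
  refine ⟨(X'.comap E'.mkQ).map B.subtype, Submodule.map_subtype_le _ _, ?_, ?_, ?_⟩
  · intro e he
    refine ⟨⟨e, hEB he⟩, ?_, rfl⟩
    have : E'.mkQ ⟨e, hEB he⟩ = 0 := (Submodule.Quotient.mk_eq_zero _).2 he
    change E'.mkQ _ ∈ X'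
    rw [this]; exact zero_mem _
  · intro b hb
    have h1 : E'.mkQ ⟨b, hb⟩ ∈ W' ⊔ X' := by rw [hX'.sup_eq_top]; trivial
    obtain ⟨_, ⟨w, hw, rfl⟩, x, hx, e⟩ := Submodule.mem_sup.1 h1
    have h2 : (b - w : Λ) ∈ (X'.comap E'.mkQ).map B.subtype := by
      refine ⟨⟨b, hb⟩ - w, ?_, rfl⟩
      change E'.mkQ _ ∈ X'
      rw [map_sub, ← e, add_sub_cancel_left]; exact hx
    have := Submodule.add_mem_sup h2 (show (w : Λ) ∈ W from hw)
    simpa using this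
  · rintro _ ⟨⟨b, hb, rfl⟩, hw⟩
    have h1 : E'.mkQ b ∈ W' ⊓ X' := ⟨⟨b, hw, rfl⟩, hb⟩
    rw [hX'.inf_eq_bot, Submodule.mem_bot] at h1
    exact (Submodule.Quotient.mk_eq_zero E').1 h1

lemma exists_p (f : Λ →ₗ[Λ] M) (hf : Function.Surjective f) (L : ℕ) (B : Submodule Λ Λ)
    (hB : ∀ x, x ∈ B ↔ f x ∈ radPow Λ M L) :
    ∃ p : B →ₗ[Λ] radLayer Λ M L, (∀ x : B, p x = 0 ↔ f x ∈ radPow Λ M (L + 1)) ∧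
      ∀ y, ∃ a, a ∈ radPow Λ Λ L ∧ ∃ h : a ∈ B, p ⟨a, h⟩ = y := by
  let r : B →ₗ[Λ] radPow Λ M L := f.restrict (p := B) (q := radPow Λ M L) fun x hx => (hB x).1 hx
  refine ⟨Submodule.mkQ _ ∘ₗ r, fun x => ?_, fun y => ?_⟩
  · rw [LinearMap.comp_apply, Submodule.mkQ_apply, Submodule.Quotient.mk_eq_zero]
    rfl
  · obtain ⟨⟨m, hm⟩, rfl⟩ := Submodule.Quotient.mk_surjective _ y
    have hm' := hm
    rw [← radPow_map f hf] at hm'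
    obtain ⟨a, ha, rfl⟩ := hm'
    exact ⟨a, ha, (hB a).2 hm, rfl⟩

lemma exists_gen [IsArtinianRing Λ] {T : Type} [AddCommGroup T] [Module Λ T]
    (hT : IsSimpleModule Λ T) (e : (M ⧸ jrad Λ M) ≃ₗ[Λ] T) :
    ∃ m : M, Function.Surjective (LinearMap.toSpanSingleton Λ M m) := by
  have := hT.nontrivial
  obtain ⟨t, ht⟩ := exists_ne (0 : T)
  obtain ⟨m, hm⟩ := Submodule.Quotient.mk_surjective _ (e.symm t)
  refine ⟨m, ?_⟩
  rw [← LinearMap.range_eq_top]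
  apply nakayama
  rw [radPow_one, eq_top_iff]
  intro y _
  obtain ⟨a, ha⟩ := IsSimpleModule.toSpanSingleton_surjective Λ ht (e (Submodule.Quotient.mk y))
  have h1 : (Submodule.Quotient.mk y : M ⧸ jrad Λ M) = Submodule.Quotient.mk (a • m) := by
    apply e.injective
    rw [← ha, Submodule.Quotient.mk_smul, hm]
    simp
  rw [Submodule.Quotient.eq] at h1
  have := Submodule.add_mem_sup (show a • m ∈ LinearMap.range (LinearMap.toSpanSingleton Λ M m) from
    ⟨a, rfl⟩) h1
  simpa using this

lemma top_quot {I F : Submodule Λ Λ} (hF : F ≤ I) (hJ : jacRad Λ ≤ I) (hI : I ≤ F ⊔ jacRad Λ) :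
    Nonempty (((Λ ⧸ F) ⧸ jrad Λ (Λ ⧸ F)) ≃ₗ[Λ] (Λ ⧸ I)) := by
  have h : I = (jrad Λ (Λ ⧸ F)).comap F.mkQ := by
    rw [← radPow_one, ← radPow_map F.mkQ (Submodule.mkQ_surjective F), radPow_self_one,
      Submodule.comap_map_mkQ]
    exact le_antisymm hI (sup_le hF hJ)
  exact ⟨(quotComap F.mkQ (Submodule.mkQ_surjective F) _ I h).some.symm⟩

end assembly2

section final

variable {K Λ : Type} [Field K] [IsAlgClosed K] [Ring Λ] [Algebra K Λ] [FiniteDimensional K Λ]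

lemma step {T : Type} [AddCommGroup T] [Module Λ T] (hT : IsSimpleModule Λ T)
    (hfin0 : ∀ G : K → Submodule Λ Λ,
      (∀ k, Nonempty (((Λ ⧸ G k) ⧸ jrad Λ (Λ ⧸ G k)) ≃ₗ[Λ] T)) →
      ∃ k l, k ≠ l ∧ Nonempty ((Λ ⧸ G k) ≃ₗ[Λ] (Λ ⧸ G l)))
    {M N : Type} [AddCommGroup M] [Module Λ M] [AddCommGroup N] [Module Λ N]
    (eM : (M ⧸ jrad Λ M) ≃ₗ[Λ] T) (L : ℕ) (hL : 1 ≤ L)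
    (θ : (M ⧸ radPow Λ M L) ≃ₗ[Λ] (N ⧸ radPow Λ N L))
    (η : radLayer Λ M L ≃ₗ[Λ] radLayer Λ N L) :
    Nonempty ((M ⧸ radPow Λ M (L + 1)) ≃ₗ[Λ] (N ⧸ radPow Λ N (L + 1))) := by
  have art : IsArtinianRing Λ := IsArtinianRing.of_finite K Λ
  have infK : Infinite K := IsAlgClosed.instInfinite
  obtain ⟨m, hm⟩ := exists_gen hT eM
  obtain ⟨n, hn⟩ := Submodule.Quotient.mk_surjective _ (θ (Submodule.Quotient.mk m))
  let f := LinearMap.toSpanSingleton Λ M m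
  let g := LinearMap.toSpanSingleton Λ N n
  have hf : Function.Surjective f := hm
  have hfg : ∀ x, θ (Submodule.Quotient.mk (f x)) = Submodule.Quotient.mk (g x) := by
    intro x
    simp only [f, g, LinearMap.toSpanSingleton_apply, Submodule.Quotient.mk_smul, map_smul, hn]
  have hg : Function.Surjective g := by
    rw [← LinearMap.range_eq_top]
    apply nakayama
    rw [eq_top_iff]
    intro y _
    obtain ⟨z, hz⟩ := θ.surjective (Submodule.Quotient.mk y)
    obtain ⟨z, rfl⟩ := Submodule.Quotient.mk_surjective _ z
    obtain ⟨x, rfl⟩ := hf z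
    rw [hfg, eq_comm, Submodule.Quotient.eq] at hz
    have := Submodule.add_mem_sup (LinearMap.mem_range_self g x) (radPow_anti hL hz)
    simpa using this
  let I := (radPow Λ M 1).comap f
  let B := (radPow Λ M L).comap f
  have hBf : ∀ x, x ∈ B ↔ f x ∈ radPow Λ M L := fun x => Iff.rfl
  have hBg : ∀ x, x ∈ B ↔ g x ∈ radPow Λ N L := by
    intro x
    rw [hBf, ← Submodule.Quotient.mk_eq_zero, ← Submodule.Quotient.mk_eq_zero (radPow Λ N L),
      ← hfg, LinearEquiv.map_eq_zero_iff]
  let A := radPow Λ Λ L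
  let E : Submodule Λ Λ := Submodule.span Λ {x | ∃ a ∈ jacRad Λ, ∃ b ∈ B, a * b = x}
  have hE : ∀ a ∈ jacRad Λ, ∀ b ∈ B, a * b ∈ E := fun a ha b hb =>
    Submodule.subset_span ⟨a, ha, b, hb, rfl⟩
  have hEle : ∀ S : Submodule Λ Λ, (∀ a ∈ jacRad Λ, ∀ b ∈ B, a * b ∈ S) → E ≤ S := by
    intro S hS
    rw [Submodule.span_le]
    rintro _ ⟨a, ha, b, hb, rfl⟩
    exact hS a ha b hb
  have hAB : A ≤ B := by
    rw [← Submodule.map_le_iff_le_comap]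
    exact (radPow_map f hf L).le
  have hEB : E ≤ B := hEle B fun a _ b hb => B.smul_mem a hb
  have hBI : B ≤ I := Submodule.comap_mono (radPow_anti hL)
  have hJI : jacRad Λ ≤ I := by
    rw [← Submodule.map_le_iff_le_comap, ← radPow_self_one]
    exact (radPow_map f hf 1).le
  have hAJ : A ≤ jacRad Λ := by
    rw [← radPow_self_one]; exact radPow_anti hL
  have hEJ : E ≤ jacRad Λ := hEle _ fun a ha b _ => jacRad_mul_right ha b
  let W := A ⊔ E
  have hEW : E ≤ W := le_sup_right
  have hWB : W ≤ B := sup_le hAB hEB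
  have hAj : ∀ a ∈ A, ∀ j ∈ jacRad Λ, a * j ∈ E := by
    intro a ha j hj
    have h1 := radPow_self_mul ha hj
    have h2 : radPow Λ Λ (L + 1) ≤ E := by
      rw [radPow_succ_le_iff]
      intro a ha b hb
      exact hE a ha b (hAB hb)
    exact h2 h1
  have hWN : ∀ j ∈ jacRad Λ, (∀ b ∈ B, b * j ∈ B) → ∀ w ∈ W, w * j ∈ E := by
    intro j hj hBj
    have : W ≤ E.comap (LinearMap.toSpanSingleton Λ Λ j) := by
      apply sup_le
      · intro a ha
        exact hAj a ha j hj
      · apply hEle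
        intro a ha b hb
        have := hE a ha _ (hBj b hb)
        simpa [mul_assoc] using this
    exact this
  obtain ⟨eI⟩ : Nonempty ((Λ ⧸ I) ≃ₗ[Λ] T) := by
    obtain ⟨e⟩ := quotComap f hf (radPow Λ M 1) I rfl
    exact ⟨e ≪≫ₗ Submodule.quotEquivOfEq _ _ radPow_one ≪≫ₗ eM⟩
  have hI : IsSimpleModule Λ (Λ ⧸ I) := IsSimpleModule.congr eI
  have hfin : ∀ F : K → Submodule Λ Λ, (∀ k, F k ≤ B ∧ E ≤ F k ∧ B ≤ F k ⊔ W) →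
      ∃ k l, k ≠ l ∧ ∃ j ∈ jacRad Λ, (∀ b ∈ B, b * j ∈ B) ∧ (∀ w ∈ W, w * j ∈ E) ∧
        ∀ x ∈ F k, x * (1 + j) ∈ F l := by
    intro F hF
    have hFI : ∀ k, F k ≤ I := fun k => (hF k).1.trans hBI
    have hIF : ∀ k, I ≤ F k ⊔ jacRad Λ := by
      intro k x hx
      have hx' : f x ∈ radPow Λ M 1 := hx
      rw [← radPow_map f hf, radPow_self_one] at hx'
      obtain ⟨j, hj, e⟩ := hx'
      have h1 : x - j ∈ B := by
        rw [hBf, map_sub, e, sub_self]; exact zero_mem _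
      have h2 : x - j ∈ F k ⊔ jacRad Λ :=
        (sup_le_sup_left (sup_le hAJ hEJ) _) ((hF k).2.2 h1)
      have := add_mem h2 (Submodule.mem_sup_right hj : j ∈ F k ⊔ jacRad Λ)
      simpa using this
    obtain ⟨k, l, hkl, ⟨φ⟩⟩ := hfin0 F fun k =>
      ⟨(top_quot (hFI k) hJI (hIF k)).some ≪≫ₗ eI⟩
    obtain ⟨j, hj, h⟩ := conj_of_iso (K := K) hI (hFI l) (hIF k) (hIF l) hJI φ
    have hBj : ∀ b ∈ B, b * j ∈ B := by
      intro b hb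
      have hb' : b ∈ F k ⊔ A := by
        have h1 : F k ⊔ W ≤ F k ⊔ A :=
          sup_le le_sup_left (sup_le le_sup_right ((hF k).2.1.trans le_sup_left))
        exact h1 ((hF k).2.2 hb)
      obtain ⟨x, hx, a, ha, rfl⟩ := Submodule.mem_sup.1 hb'
      have h1 := sub_mem ((hF l).1 (h x hx)) ((hF k).1 hx)
      rw [mul_add, mul_one, add_sub_cancel_left] at h1
      rw [add_mul]
      exact add_mem h1 (hEB (hAj a ha j hj))
    exact ⟨k, l, hkl, j, hj, hBj, hWN j hj hBj, h⟩
  obtain ⟨X, hXB, hEX, hXW, hXWE⟩ := exists_complement (W := W) hEB hE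
  obtain ⟨p, hp0, hps⟩ := exists_p f hf L B hBf
  obtain ⟨p', hp0', hps'⟩ := exists_p g hg L B hBg
  let _ : Module K (radLayer Λ M L) := Module.compHom _ (algebraMap K Λ)
  have : IsScalarTower K Λ (radLayer Λ M L) := IsScalarTower.of_algebraMap_smul fun _ _ => rfl
  have hEf : E ≤ (radPow Λ M (L + 1)).comap f := hEle _ fun a ha b hb => by
    rw [Submodule.mem_comap, ← smul_eq_mul, map_smul]
    exact smul_mem_radPow ha ((hBf b).1 hb)
  have hEg : E ≤ (radPow Λ N (L + 1)).comap g := hEle _ fun a ha b hb => by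
    rw [Submodule.mem_comap, ← smul_eq_mul, map_smul]
    exact smul_mem_radPow ha ((hBg b).1 hb)
  obtain ⟨j, hj, hiff⟩ := core (K := K) hEW hWB X hXB hEX hXW hXWE p
    (η.symm.toLinearMap ∘ₗ p')
    (fun y => by
      obtain ⟨a, ha, h, e⟩ := hps y
      exact ⟨a, Submodule.mem_sup_left ha, e⟩)
    (fun y => by
      obtain ⟨a, ha, h, e⟩ := hps' (η y)
      refine ⟨a, Submodule.mem_sup_left ha, ?_⟩
      rw [LinearMap.comp_apply, e]; simp)
    (fun w h => (hp0 _).2 (hEf h))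
    (fun w h => by
      rw [LinearMap.comp_apply, (hp0' _).2 (hEg h), map_zero])
    hWN hfin
  obtain ⟨e⟩ := iso_of_conj (C := (radPow Λ N (L + 1)).comap g)
    (C' := (radPow Λ M (L + 1)).comap f) hj (by
      intro x
      have h1 : x ∈ (radPow Λ N (L + 1)).comap g ↔
          (∃ h : x ∈ B, (η.symm.toLinearMap ∘ₗ p') ⟨x, h⟩ = 0) := by
        constructor
        · intro hx
          have hxB : x ∈ B := (hBg x).2 (radPow_succ_le _ hx)
          refine ⟨hxB, ?_⟩
          rw [LinearMap.comp_apply, (hp0' ⟨x, hxB⟩).2 hx, map_zero]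
        · rintro ⟨h, h0⟩
          rw [LinearMap.comp_apply, LinearEquiv.coe_coe, LinearEquiv.map_eq_zero_iff] at h0
          exact (hp0' _).1 h0
      have h2 : ∀ y, y ∈ (radPow Λ M (L + 1)).comap f ↔ (∃ h : y ∈ B, p ⟨y, h⟩ = 0) := by
        intro y
        constructor
        · intro hy
          have hyB : y ∈ B := (hBf y).2 (radPow_succ_le _ hy)
          exact ⟨hyB, (hp0 ⟨y, hyB⟩).2 hy⟩
        · rintro ⟨h, h0⟩
          exact (hp0 _).1 h0
      rw [h1, h2]
      exact hiff x)
  obtain ⟨e1⟩ := quotComap f hf (radPow Λ M (L + 1)) _ rfl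
  obtain ⟨e2⟩ := quotComap g hg (radPow Λ N (L + 1)) _ rfl
  exact ⟨e1.symm ≪≫ₗ e.symm ≪≫ₗ e2⟩

lemma layer_code [IsArtinianRing Λ] (l : ℕ) :
    ∃ (n : ℕ) (S : Fin n → Submodule Λ (radLayer Λ Λ l)),
      ∀ (M : Type) [AddCommGroup M] [Module Λ M] (f : Λ →ₗ[Λ] M), Function.Surjective f →
        ∃ i, Nonempty (radLayer Λ M l ≃ₗ[Λ] S i) := by
  have ss : IsSemisimpleModule Λ (radLayer Λ Λ l) := by
    apply semisimple_of_jac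
    intro a ha m
    obtain ⟨b, rfl⟩ := Submodule.Quotient.mk_surjective _ m
    rw [← Submodule.Quotient.mk_smul, Submodule.Quotient.mk_eq_zero]
    exact smul_mem_radPow ha b.2
  obtain ⟨n, S, hS⟩ := finite_quotients (Λ := Λ) (M := radLayer Λ Λ l)
  refine ⟨n, S, fun M _ _ f hf => ?_⟩
  let r : radPow Λ Λ l →ₗ[Λ] radPow Λ M l :=
    f.restrict (p := radPow Λ Λ l) (q := radPow Λ M l)
      fun x hx => (radPow_map f hf l).le (Submodule.mem_map_of_mem hx)
  have hr : Function.Surjective r := by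
    rintro ⟨m, hm⟩
    have hm' := hm
    rw [← radPow_map f hf] at hm'
    obtain ⟨a, ha, rfl⟩ := hm'
    exact ⟨⟨a, ha⟩, rfl⟩
  let q : radLayer Λ Λ l →ₗ[Λ] radLayer Λ M l := Submodule.mapQ _ _ r (by
    intro x hx
    exact (radPow_map f hf (l + 1)).le (Submodule.mem_map_of_mem hx))
  have hq : Function.Surjective q := by
    intro y
    obtain ⟨y, rfl⟩ := Submodule.Quotient.mk_surjective _ y
    obtain ⟨x, rfl⟩ := hr y
    exact ⟨Submodule.Quotient.mk x, rfl⟩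
  obtain ⟨i, ⟨e⟩⟩ := hS (LinearMap.ker q)
  exact ⟨i, ⟨(q.quotKerEquivOfSurjective hq).symm ≪≫ₗ e⟩⟩

end final

/-- For a simple `Λ`-module `T`, the following are equivalent:
(i) up to isomorphism there are only finitely many finite-dimensional `Λ`-modules with top
isomorphic to `T`; (ii) any two finite-dimensional `Λ`-modules with top isomorphic to `T`
and isomorphic radical layerings are isomorphic. -/
theorem stmt3 {K Λ : Type} [Field K] [IsAlgClosed K] [Ring Λ] [Algebra K Λ]
    [FiniteDimensional K Λ]
    (T : Type) [AddCommGroup T] [Module Λ T] (hT : IsSimpleModule Λ T) :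
    -- (i) finitely many modules with top `T`, up to isomorphism:
    (∃ (n : ℕ) (rep : Fin n → ModuleCat Λ),
      ∀ (M : Type) (_ : AddCommGroup M) (_ : Module Λ M),
        FinDimMod K Λ M →
        Nonempty ((M ⧸ jrad Λ M) ≃ₗ[Λ] T) →
        ∃ i : Fin n, Nonempty (M ≃ₗ[Λ] (rep i : Type)))
    ↔
    -- (ii) the radical layering classifies the modules with top `T`:
    (∀ (M : Type) (_ : AddCommGroup M) (_ : Module Λ M)
       (N : Type) (_ : AddCommGroup N) (_ : Module Λ N),
        FinDimMod K Λ M → FinDimMod K Λ N →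
        Nonempty ((M ⧸ jrad Λ M) ≃ₗ[Λ] T) →
        Nonempty ((N ⧸ jrad Λ N) ≃ₗ[Λ] T) →
        (∀ l : ℕ, Nonempty (radLayer Λ M l ≃ₗ[Λ] radLayer Λ N l)) →
        Nonempty (M ≃ₗ[Λ] N)) := by
  have art : IsArtinianRing Λ := IsArtinianRing.of_finite K Λ
  have infK : Infinite K := IsAlgClosed.instInfinite
  constructor
  · rintro ⟨n, rep, hrep⟩ M _ _ N _ _ hM hN ⟨eM⟩ ⟨eN⟩ hlay
    have hfin0 : ∀ G : K → Submodule Λ Λ,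
        (∀ k, Nonempty (((Λ ⧸ G k) ⧸ jrad Λ (Λ ⧸ G k)) ≃ₗ[Λ] T)) →
        ∃ k l, k ≠ l ∧ Nonempty ((Λ ⧸ G k) ≃ₗ[Λ] (Λ ⧸ G l)) := by
      intro G hG
      have := fun k => hrep (Λ ⧸ G k) inferInstance inferInstance
        ((finDim_iff _).2 inferInstance) (hG k)
      choose i hi using this
      obtain ⟨k, l, hkl, h⟩ := Finite.exists_ne_map_eq_of_infinite i
      obtain ⟨e1⟩ := hi k
      obtain ⟨e2⟩ := hi l
      rw [← h] at e2
      exact ⟨k, l, hkl, ⟨e1 ≪≫ₗ e2.symm⟩⟩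
    have main : ∀ L, Nonempty ((M ⧸ radPow Λ M (L + 1)) ≃ₗ[Λ] (N ⧸ radPow Λ N (L + 1))) := by
      intro L
      induction L with
      | zero =>
        exact ⟨Submodule.quotEquivOfEq _ _ radPow_one ≪≫ₗ eM ≪≫ₗ eN.symm ≪≫ₗ
          (Submodule.quotEquivOfEq _ _ radPow_one).symm⟩
      | succ L ih =>
        exact step hT hfin0 eM (L + 1) (by omega) ih.some (hlay _).some
    obtain ⟨L1, h1⟩ := exists_radPow_eq_bot (Λ := Λ) M
    obtain ⟨L2, h2⟩ := exists_radPow_eq_bot (Λ := Λ) N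
    obtain ⟨e⟩ := main (L1 + L2)
    rw [h1 (L1 + L2 + 1) (by omega), h2 (L1 + L2 + 1) (by omega)] at e
    exact ⟨(Submodule.quotEquivOfEqBot _ rfl).symm ≪≫ₗ e ≪≫ₗ Submodule.quotEquivOfEqBot _ rfl⟩
  · intro h
    obtain ⟨L, hL⟩ := exists_radPow_eq_bot (Λ := Λ) Λ
    choose n S hS using fun l => layer_code (Λ := Λ) l
    let Code := (l : Fin L) → Fin (n l)
    let Q : ModuleCat.{0} Λ → Code → Prop := fun X c => FinDimMod K Λ X ∧
      Nonempty ((X ⧸ jrad Λ X) ≃ₗ[Λ] T) ∧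
      ∀ l : Fin L, Nonempty (radLayer Λ X l ≃ₗ[Λ] S l (c l))
    have hch : ∀ c : Code, ∃ X : ModuleCat.{0} Λ, (∃ X', Q X' c) → Q X c := by
      intro c
      by_cases hc : ∃ X', Q X' c
      · obtain ⟨X', hX'⟩ := hc
        exact ⟨X', fun _ => hX'⟩
      · exact ⟨ModuleCat.of Λ T, fun h => absurd h hc⟩
    choose R hR using hch
    let e := Fintype.equivFin Code
    refine ⟨Fintype.card Code, fun i => R (e.symm i), ?_⟩
    intro M _ _ hM hMT
    obtain ⟨m, hm⟩ := exists_gen hT hMT.some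
    choose c hc using fun l => hS l M _ hm
    let c' : Code := fun l => c l
    have hQ : Q (R c') c' := hR c' ⟨ModuleCat.of Λ M, hM, hMT, fun l => hc l⟩
    refine ⟨e c', ?_⟩
    have he : R (e.symm (e c')) = R c' := by rw [e.symm_apply_apply]
    beta_reduce
    rw [he]
    obtain ⟨hX1, hX2, hX3⟩ := hQ
    refine h M _ _ (R c') _ _ hM hX1 hMT hX2 fun l => ?_
    by_cases hl : l < L
    · exact ⟨(hc l).some ≪≫ₗ (hX3 ⟨l, hl⟩).some.symm⟩
    · have hsub : ∀ (X : Type) [AddCommGroup X] [Module Λ X],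
          Nonempty ((X ⧸ jrad Λ X) ≃ₗ[Λ] T) → Subsingleton (radLayer Λ X l) := by
        intro X _ _ hX
        obtain ⟨x, hx⟩ := exists_gen hT hX.some
        have hb : radPow Λ X l = ⊥ := by
          rw [← radPow_map _ hx, hL l (by omega), Submodule.map_bot]
        have : Subsingleton (radPow Λ X l) := by rw [hb]; infer_instance
        exact (Submodule.mkQ_surjective _).subsingleton
      have := hsub M hMT
      have := hsub (R c') hX2
      exact ⟨0⟩
end

section
/- Let T be a squarefree semisimple Λ-module with projective cover P, and let C ⊆ JP be a Λ-submodule. Then C is invariant under every Λ-endomorphism of P if and only if C is the unique Λ-submodule C' ⊆ JP with P/C' ≅ P/C. -/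
open Module

theorem jrad_le_jacobson (Λ : Type) [Ring Λ] (M : Type) [AddCommGroup M] [Module Λ M] :
    jrad Λ M ≤ Module.jacobson Λ M := by
  refine Submodule.span_le.mpr ?_
  rintro _ ⟨a, ha, m, rfl⟩
  rw [jacRad, Ideal.jacobson_bot] at ha
  exact Module.le_comap_jacobson (LinearMap.toSpanSingleton Λ M m) ha

theorem map_jrad_le {Λ : Type} [Ring Λ] {M : Type} [AddCommGroup M] [Module Λ M]
    (g : M →ₗ[Λ] M) : (jrad Λ M).map g ≤ jrad Λ M := by
  rw [Submodule.map_le_iff_le_comap]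
  refine Submodule.span_le.mpr ?_
  rintro _ ⟨a, ha, m, rfl⟩
  exact Submodule.subset_span ⟨a, ha, g m, (g.map_smul a m).symm⟩

/-- Let `T` be a squarefree semisimple `Λ`-module with projective cover `P`
and `C ⊆ JP` a `Λ`-submodule.  Then `C` is invariant under every `Λ`-endomorphism of `P` if
and only if `C` is the unique `Λ`-submodule `C' ⊆ JP` with `P/C' ≅ P/C`. -/
theorem stmt5 {K Λ : Type} [Field K] [IsAlgClosed K] [Ring Λ] [Algebra K Λ]
    [FiniteDimensional K Λ]
    (T : Type) [AddCommGroup T] [Module Λ T] [Module K T] [IsScalarTower K Λ T]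
    [FiniteDimensional K T]
    (P : Type) [AddCommGroup P] [Module Λ P] [Module K P] [IsScalarTower K Λ P]
    [FiniteDimensional K P]
    -- `T` is semisimple and squarefree:
    (hss : IsSemisimpleModule Λ T)
    (hsf : ∀ S S' : Submodule Λ T, IsSimpleModule Λ ↥S → IsSimpleModule Λ ↥S' →
        Nonempty (↥S ≃ₗ[Λ] ↥S') → S = S')
    -- `P` is a projective cover of `T`:
    (hproj : Module.Projective Λ P)
    (hcover : Nonempty ((P ⧸ jrad Λ P) ≃ₗ[Λ] T))
    (C : Submodule Λ P) (hC : C ≤ jrad Λ P) :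
    (∀ f : P →ₗ[Λ] P, C.map f ≤ C) ↔
    (∀ C' : Submodule Λ P, C' ≤ jrad Λ P →
        Nonempty ((P ⧸ C') ≃ₗ[Λ] (P ⧸ C)) → C' = C) := by
  constructor
  · rintro h C' hC' ⟨φ⟩
    obtain ⟨f, hf⟩ := Module.projective_lifting_property C.mkQ (φ.toLinearMap ∘ₗ C'.mkQ)
      C.mkQ_surjective
    have hf' : ∀ x, C.mkQ (f x) = φ (C'.mkQ x) := fun x => LinearMap.congr_fun hf x
    have hiff : ∀ x, f x ∈ C ↔ x ∈ C' := by
      intro x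
      have h1 := hf' x
      rw [← Submodule.Quotient.mk_eq_zero C, ← Submodule.Quotient.mk_eq_zero C',
        ← Submodule.mkQ_apply, ← Submodule.mkQ_apply, h1, LinearEquiv.map_eq_zero_iff]
    have hfin : Module.Finite Λ P := Module.Finite.of_restrictScalars_finite K Λ P
    have hsup : LinearMap.range f ⊔ jrad Λ P = ⊤ := by
      rw [eq_top_iff]
      intro y _
      obtain ⟨x, hx⟩ := C'.mkQ_surjective (φ.symm (C.mkQ y))
      have h2 : C.mkQ (y - f x) = 0 := by
        rw [map_sub, hf', hx, LinearEquiv.apply_symm_apply, sub_self]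
      have h3 : y - f x ∈ C := by
        rwa [Submodule.mkQ_apply, Submodule.Quotient.mk_eq_zero] at h2
      rw [Submodule.mem_sup]
      exact ⟨f x, ⟨x, rfl⟩, y - f x, hC h3, by abel⟩
    have hrange : LinearMap.range f = ⊤ := by
      rcases eq_top_or_exists_le_coatom (LinearMap.range f) with h4 | ⟨N, hN, hle⟩
      · exact h4
      · exfalso
        apply hN.1
        rw [eq_top_iff, ← hsup]
        refine sup_le hle ((jrad_le_jacobson Λ P).trans ?_)
        exact sInf_le hN
    have hsurj : Function.Surjective f := LinearMap.range_eq_top.mp hrange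
    have hinj : Function.Injective f :=
      (LinearMap.injective_iff_surjective (f := f.restrictScalars K)).mpr hsurj
    let e := LinearEquiv.ofBijective f ⟨hinj, hsurj⟩
    apply le_antisymm
    · intro x hx
      have h5 := h e.symm.toLinearMap ⟨f x, (hiff x).mpr hx, rfl⟩
      have h6 : e.symm (f x) = x := e.symm_apply_apply x
      rw [← h6]
      exact h5
    · intro x hx
      exact (hiff x).mp (h f ⟨x, hx, rfl⟩)
  · intro h f
    have hcomm : SMulCommClass K Λ P := IsScalarTower.to_smulCommClass
    have hcomm' : SMulCommClass Λ K P := SMulCommClass.symm _ _ _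
    have hinf : Infinite K := IsAlgClosed.instInfinite
    obtain ⟨c, hc⟩ := (Module.End.finite_hasEigenvalue
      (f.restrictScalars K : Module.End K P)).infinite_compl.nonempty
    let g : P →ₗ[Λ] P := f - c • LinearMap.id
    have hg : ∀ x, g x = f x - c • x := fun x => rfl
    have hinj : Function.Injective g := by
      rw [injective_iff_map_eq_zero]
      intro x hx
      by_contra hne
      apply hc
      refine Module.End.hasEigenvalue_of_hasEigenvector (x := x) ⟨?_, hne⟩
      rw [Module.End.mem_eigenspace_iff]
      rw [hg, sub_eq_zero] at hx
      exact hx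
    have hsurj : Function.Surjective g :=
      (LinearMap.injective_iff_surjective (f := g.restrictScalars K)).mp hinj
    let e := LinearEquiv.ofBijective g ⟨hinj, hsurj⟩
    have heq : C.map g = C := by
      apply h
      · exact (Submodule.map_mono hC).trans (map_jrad_le g)
      · exact ⟨(Submodule.Quotient.equiv C (C.map g) e rfl).symm⟩
    rintro _ ⟨x, hx, rfl⟩
    have h1 : g x ∈ C := heq ▸ Submodule.mem_map_of_mem hx
    have h2 : c • x ∈ C := by
      rw [← algebraMap_smul Λ c x]
      exact C.smul_mem _ hx
    have h3 : f x = g x + c • x := by rw [hg]; abel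
    rw [h3]
    exact C.add_mem h1 h2
end

section
/- Let T be a squarefree semisimple Λ-module with exactly t simple direct summands, let P be a projective cover of T, let C ⊆ JP be a Λ-submodule, and set M = P/C. Then C is invariant under every Λ-endomorphism of P if and only if M is a direct sum of local modules and μ_T(M) = t + dim_K Hom_Λ(M, JM). -/
open Module

set_option linter.unusedSectionVars false

section homs
variable {K Λ : Type} [Field K] [Ring Λ] [Algebra K Λ]

lemma fin_hom (A B : Type) [AddCommGroup A] [Module Λ A] [Module K A] [IsScalarTower K Λ A]
    [FiniteDimensional K A] [AddCommGroup B] [Module Λ B] [Module K B] [IsScalarTower K Λ B]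
    [FiniteDimensional K B] : FiniteDimensional K (A →ₗ[Λ] B) :=
  Module.Finite.of_injective (LinearMap.restrictScalarsₗ K Λ A B K)
    (LinearMap.restrictScalars_injective K)

lemma hom_exact (P N X Y : Type) [AddCommGroup P] [Module Λ P] [Module K P] [IsScalarTower K Λ P]
    [FiniteDimensional K P] [AddCommGroup N] [Module Λ N] [Module K N] [IsScalarTower K Λ N]
    [AddCommGroup X] [Module Λ X] [Module K X] [IsScalarTower K Λ X]
    [FiniteDimensional K X] [AddCommGroup Y] [Module Λ Y] [Module K Y] [IsScalarTower K Λ Y]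
    [Module.Projective Λ P] (i : N →ₗ[Λ] X) (p : X →ₗ[Λ] Y) (hi : Function.Injective i)
    (hp : Function.Surjective p) (hip : LinearMap.range i = LinearMap.ker p) :
    finrank K (P →ₗ[Λ] X) = finrank K (P →ₗ[Λ] N) + finrank K (P →ₗ[Λ] Y) := by
  have := fin_hom (K := K) (Λ := Λ) P X
  let F : (P →ₗ[Λ] X) →ₗ[K] (P →ₗ[Λ] Y) := LinearMap.compRight K p
  let G : (P →ₗ[Λ] N) →ₗ[K] (P →ₗ[Λ] X) := LinearMap.compRight K i
  have hG : Function.Injective G := by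
    intro a b h
    ext x
    exact hi (LinearMap.congr_fun h x)
  have hF : LinearMap.range F = ⊤ := by
    rw [LinearMap.range_eq_top]
    intro g
    exact Module.projective_lifting_property p g hp
  have hr : LinearMap.range G = LinearMap.ker F := by
    apply le_antisymm
    · rintro _ ⟨g, rfl⟩
      rw [LinearMap.mem_ker]
      ext x
      have : i (g x) ∈ LinearMap.ker p := hip ▸ ⟨_, rfl⟩
      exact this
    · intro f hf
      have hf' : ∀ x, f x ∈ LinearMap.range i := fun x => by
        rw [hip]; exact LinearMap.congr_fun hf x
      let e := LinearEquiv.ofInjective i hi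
      refine ⟨e.symm.toLinearMap ∘ₗ (f.codRestrict _ hf'), ?_⟩
      ext x
      have := congrArg Subtype.val (e.apply_symm_apply ⟨f x, hf' x⟩)
      exact this
  have h1 := F.finrank_range_add_finrank_ker
  rw [hF, finrank_top, ← hr, LinearMap.finrank_range_of_inj hG] at h1
  omega

lemma finrank_hom_congr (P X Y : Type) [AddCommGroup P] [Module Λ P]
    [AddCommGroup X] [Module Λ X] [Module K X] [IsScalarTower K Λ X]
    [AddCommGroup Y] [Module Λ Y] [Module K Y] [IsScalarTower K Λ Y] (e : X ≃ₗ[Λ] Y) :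
    finrank K (P →ₗ[Λ] X) = finrank K (P →ₗ[Λ] Y) := by
  refine LinearEquiv.finrank_eq (LinearEquiv.ofBijective
    (LinearMap.compRight K e.toLinearMap : (P →ₗ[Λ] X) →ₗ[K] (P →ₗ[Λ] Y)) ⟨?_, ?_⟩)
  · intro a b h
    ext x
    exact e.injective (LinearMap.congr_fun h x)
  · intro g
    refine ⟨e.symm.toLinearMap ∘ₗ g, ?_⟩
    ext x
    exact e.apply_symm_apply _

lemma finrank_hom_lcomp (P Q X : Type) [AddCommGroup P] [Module Λ P]
    [AddCommGroup Q] [Module Λ Q]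
    [AddCommGroup X] [Module Λ X] [Module K X] [IsScalarTower K Λ X]
    (p : P →ₗ[Λ] Q) (hp : Function.Surjective p)
    (h : ∀ f : P →ₗ[Λ] X, LinearMap.ker p ≤ LinearMap.ker f) :
    finrank K (Q →ₗ[Λ] X) = finrank K (P →ₗ[Λ] X) := by
  refine LinearEquiv.finrank_eq (LinearEquiv.ofBijective
    (LinearMap.lcomp K X p : (Q →ₗ[Λ] X) →ₗ[K] (P →ₗ[Λ] X)) ⟨?_, ?_⟩)
  · intro a b h
    exact (LinearMap.cancel_right hp).1 h
  · intro f
    refine ⟨(LinearMap.ker p).liftQ f (h f) ∘ₗ (p.quotKerEquivOfSurjective hp).symm.toLinearMap, ?_⟩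
    ext x
    have : (p.quotKerEquivOfSurjective hp).symm (p x) = (LinearMap.ker p).mkQ x := by
      rw [LinearEquiv.symm_apply_eq]; rfl
    simp [LinearMap.lcomp_apply, this]

lemma lcomp_kills (P Q X : Type) [AddCommGroup P] [Module Λ P] [Module K P] [IsScalarTower K Λ P]
    [FiniteDimensional K P]
    [AddCommGroup Q] [Module Λ Q]
    [AddCommGroup X] [Module Λ X] [Module K X] [IsScalarTower K Λ X] [FiniteDimensional K X]
    (p : P →ₗ[Λ] Q) (hp : Function.Surjective p)
    (h : finrank K (Q →ₗ[Λ] X) = finrank K (P →ₗ[Λ] X)) (f : P →ₗ[Λ] X) :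
    LinearMap.ker p ≤ LinearMap.ker f := by
  have := fin_hom (K := K) (Λ := Λ) P X
  let F := (LinearMap.lcomp K X p : (Q →ₗ[Λ] X) →ₗ[K] (P →ₗ[Λ] X))
  have hF : Function.Injective F := by
    intro a b h
    exact (LinearMap.cancel_right hp).1 h
  have hF2 : LinearMap.range F = ⊤ := by
    apply Submodule.eq_top_of_finrank_eq
    rw [LinearMap.finrank_range_of_inj hF, h]
  obtain ⟨g, rfl⟩ := LinearMap.range_eq_top.1 hF2 f
  intro x hx
  have hx : p x = 0 := hx
  simp [F, LinearMap.lcomp_apply, hx]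

end homs

section rad
variable {Λ : Type} [Ring Λ]

lemma jrad_eq (M : Type) [AddCommGroup M] [Module Λ M] :
    jrad Λ M = jacRad Λ • (⊤ : Submodule Λ M) := by
  apply le_antisymm
  · refine Submodule.span_le.2 ?_
    rintro _ ⟨a, ha, m, rfl⟩
    exact Submodule.smul_mem_smul ha trivial
  · refine Submodule.smul_le.2 fun a ha m _ => Submodule.subset_span ⟨a, ha, m, rfl⟩

lemma jrad_map {M N : Type} [AddCommGroup M] [Module Λ M] [AddCommGroup N] [Module Λ N]
    (f : M →ₗ[Λ] N) : (jrad Λ M).map f ≤ jrad Λ N := by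
  rw [Submodule.map_le_iff_le_comap]
  refine Submodule.span_le.2 ?_
  rintro _ ⟨a, ha, m, rfl⟩
  exact Submodule.subset_span ⟨a, ha, f m, (f.map_smul a m).symm⟩

lemma jrad_map_surj {M N : Type} [AddCommGroup M] [Module Λ M] [AddCommGroup N] [Module Λ N]
    (f : M →ₗ[Λ] N) (hf : Function.Surjective f) : (jrad Λ M).map f = jrad Λ N := by
  refine le_antisymm (jrad_map f) ?_
  refine Submodule.span_le.2 ?_
  rintro _ ⟨a, ha, m, rfl⟩
  obtain ⟨m, rfl⟩ := hf m
  exact ⟨a • m, Submodule.subset_span ⟨a, ha, m, rfl⟩, f.map_smul a m⟩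

lemma jrad_ss (M : Type) [AddCommGroup M] [Module Λ M] [IsSemisimpleModule Λ M] :
    jrad Λ M = ⊥ := by
  refine eq_bot_iff.2 (Submodule.span_le.2 ?_)
  rintro _ ⟨a, ha, m, rfl⟩
  have h := IsSemisimpleModule.jacobson_le_annihilator Λ M
    (show a ∈ Ring.jacobson Λ by rwa [← Ideal.jacobson_bot])
  exact Module.mem_annihilator.1 h m

lemma nilp_of_range [IsArtinianRing Λ] {M : Type} [AddCommGroup M] [Module Λ M]
    (f : Module.End Λ M) (hf : ∀ x, f x ∈ jrad Λ M) : IsNilpotent f := by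
  obtain ⟨n, hn⟩ := IsArtinianRing.isNilpotent_jacobson_bot (R := Λ)
  have key : ∀ k x, (f ^ k) x ∈ (jacRad Λ ^ k) • (⊤ : Submodule Λ M) := by
    intro k
    induction k with
    | zero =>
      intro x
      rw [Submodule.pow_zero, Ideal.one_eq_top]
      simpa using Submodule.smul_mem_smul (show (1 : Λ) ∈ (⊤ : Ideal Λ) from trivial)
        (show x ∈ (⊤ : Submodule Λ M) from trivial)
    | succ k ih =>
      intro x
      rw [pow_succ', Module.End.mul_apply, Submodule.pow_succ, Submodule.mul_smul]
      refine Submodule.smul_induction_on (ih x) ?_ ?_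
      · intro r hr m _
        rw [map_smul]
        refine Submodule.smul_mem_smul hr ?_
        rw [← jrad_eq]; exact hf m
      · intro a b ha hb
        rw [map_add]; exact add_mem ha hb
  refine ⟨n, ?_⟩
  ext x
  have := key n x
  rw [show jacRad Λ ^ n = 0 from hn] at this
  simpa using this
end rad

section sq
variable {K Λ : Type} [Field K] [IsAlgClosed K] [Ring Λ] [Algebra K Λ]
  (T : Type) [AddCommGroup T] [Module Λ T] [Module K T] [IsScalarTower K Λ T]
    [FiniteDimensional K T]

lemma finrank_end (S : Type) [AddCommGroup S] [Module Λ S] [Module K S] [IsScalarTower K Λ S]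
    [FiniteDimensional K S] [IsSimpleModule Λ S] : finrank K (S →ₗ[Λ] S) = 1 := by
  have h := IsSimpleModule.algebraMap_end_bijective_of_isAlgClosed (A := Λ) (V := S) K
  have := LinearEquiv.finrank_eq (LinearEquiv.ofBijective (Algebra.linearMap K (Module.End Λ S)) h)
  simpa using this.symm

lemma finrank_end_T (hss : IsSemisimpleModule Λ T)
    (hsf : ∀ S S' : Submodule Λ T, IsSimpleModule Λ ↥S → IsSimpleModule Λ ↥S' →
        Nonempty (↥S ≃ₗ[Λ] ↥S') → S = S') :
    finrank K (T →ₗ[Λ] T) = Nat.card {S : Submodule Λ T // IsSimpleModule Λ ↥S} ∧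
    isotypicComponents Λ T = {S : Submodule Λ T | IsSimpleModule Λ ↥S} := by
  classical
  have hi : ∀ S : Submodule Λ T, IsSimpleModule Λ S → isotypicComponent Λ T S = S := by
    intro S hS
    apply le_antisymm
    · refine sSup_le ?_
      rintro m ⟨e⟩
      have : IsSimpleModule Λ m := IsSimpleModule.congr e
      exact (hsf m S this hS ⟨e⟩).le
    · exact S.le_isotypicComponent
  have hi2 : isotypicComponents Λ T = {S : Submodule Λ T | IsSimpleModule Λ ↥S} := by
    ext S
    constructor
    · rintro ⟨S, hS, rfl⟩
      rw [hi S hS]; exact hS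
    · intro hS
      exact ⟨S, hS, (hi S hS).symm⟩
  refine ⟨?_, hi2⟩
  have : IsNoetherian Λ T := isNoetherian_of_tower K inferInstance
  have : Fintype (isotypicComponents Λ T) := Fintype.ofFinite _
  have hfd : ∀ c : isotypicComponents Λ T, FiniteDimensional K (Module.End Λ c.1) := fun c =>
    have : FiniteDimensional K c.1 := FiniteDimensional.of_injective
      (c.1.subtype.restrictScalars K) (Subtype.val_injective)
    fin_hom _ _
  have h := LinearEquiv.finrank_eq (IsSemisimpleModule.endAlgEquiv K Λ T).toLinearEquiv
  refine h.trans ?_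
  rw [Module.finrank_pi_fintype]
  have h1 : ∀ c : isotypicComponents Λ T, finrank K (Module.End Λ c.1) = 1 := by
    intro c
    have : FiniteDimensional K c.1 := FiniteDimensional.of_injective
      (c.1.subtype.restrictScalars K) (Subtype.val_injective)
    have : IsSimpleModule Λ c.1 := hi2.le c.2
    exact finrank_end _
  simp only [h1]
  rw [Finset.sum_const, smul_eq_mul, mul_one, Finset.card_univ, ← Nat.card_eq_fintype_card]
  exact Nat.card_congr (Equiv.setCongr hi2)

/-- dimension of Hom from squarefree module to simple one -/
lemma finrank_hom_simple (hss : IsSemisimpleModule Λ T)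
    (hsf : ∀ S S' : Submodule Λ T, IsSimpleModule Λ ↥S → IsSimpleModule Λ ↥S' →
        Nonempty (↥S ≃ₗ[Λ] ↥S') → S = S')
    (X : Type) [AddCommGroup X] [Module Λ X] [Module K X] [IsScalarTower K Λ X]
    [FiniteDimensional K X] [IsSimpleModule Λ X] [Decidable (∃ S : Submodule Λ T,
      IsSimpleModule Λ ↥S ∧ Nonempty (X ≃ₗ[Λ] ↥S))] :
    finrank K (T →ₗ[Λ] X) = if (∃ S : Submodule Λ T,
      IsSimpleModule Λ ↥S ∧ Nonempty (X ≃ₗ[Λ] ↥S)) then 1 else 0 := by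
  have hx : ∀ f : T →ₗ[Λ] X, f ≠ 0 → ∃ S : Submodule Λ T, IsSimpleModule Λ S ∧
      Nonempty (X ≃ₗ[Λ] S) ∧ Disjoint (LinearMap.ker f) S := by
    intro f hf
    have hs := (LinearMap.surjective_or_eq_zero f).resolve_right hf
    obtain ⟨S, hS⟩ := exists_isCompl (LinearMap.ker f)
    have e := (Submodule.quotientEquivOfIsCompl _ _ hS).symm.trans (f.quotKerEquivOfSurjective hs)
    exact ⟨S, IsSimpleModule.congr e, ⟨e.symm⟩, hS.disjoint⟩
  split_ifs with h
  · obtain ⟨S, hS, ⟨e⟩⟩ := h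
    rw [← finrank_end (K := K) (Λ := Λ) X]
    refine LinearEquiv.finrank_eq (LinearEquiv.ofBijective
      (LinearMap.lcomp K X (S.subtype ∘ₗ e.toLinearMap) :
        (T →ₗ[Λ] X) →ₗ[K] (X →ₗ[Λ] X)) ⟨?_, ?_⟩)
    · rw [injective_iff_map_eq_zero]
      intro f hf
      by_contra hne
      obtain ⟨S', hS', ⟨e'⟩, hd⟩ := hx f hne
      obtain rfl := hsf S S' hS hS' ⟨e.symm.trans e'⟩
      have hle : S ≤ LinearMap.ker f := by
        intro s hs
        have := LinearMap.congr_fun hf (e.symm ⟨s, hs⟩)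
        simpa [LinearMap.lcomp_apply] using this
      have hb : S = ⊥ := by
        have := hd.mono_left hle
        exact disjoint_self.1 this
      exact (Submodule.nontrivial_iff_ne_bot.1 (IsSimpleModule.nontrivial Λ S)) hb
    · intro g
      obtain ⟨S', hc⟩ := exists_isCompl S
      refine ⟨g ∘ₗ e.symm.toLinearMap ∘ₗ Submodule.projectionOnto S S' hc, ?_⟩
      ext x
      simp [LinearMap.lcomp_apply]
  · have h0 : ∀ f : T →ₗ[Λ] X, f = 0 := by
      intro f
      by_contra hne
      obtain ⟨S, h1, h2, _⟩ := hx f hne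
      exact h ⟨S, h1, h2⟩
    have : Subsingleton (T →ₗ[Λ] X) := ⟨fun a b => (h0 a).trans (h0 b).symm⟩
    exact Module.finrank_zero_of_subsingleton

lemma simple_to_T
    (hsf : ∀ S S' : Submodule Λ T, IsSimpleModule Λ ↥S → IsSimpleModule Λ ↥S' →
        Nonempty (↥S ≃ₗ[Λ] ↥S') → S = S')
    (X : Type) [AddCommGroup X] [Module Λ X] [Module K X] [IsScalarTower K Λ X]
    [FiniteDimensional K X] [IsSimpleModule Λ X] (f g : X →ₗ[Λ] T) (hg : g ≠ 0) :
    ∃ c : K, f = c • g := by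
  by_cases hf : f = 0
  · exact ⟨0, by simp [hf]⟩
  have hfi := (LinearMap.injective_or_eq_zero f).resolve_right hf
  have hgi := (LinearMap.injective_or_eq_zero g).resolve_right hg
  let ef := LinearEquiv.ofInjective f hfi
  let eg := LinearEquiv.ofInjective g hgi
  have hr := hsf _ _ (IsSimpleModule.congr ef.symm) (IsSimpleModule.congr eg.symm)
    ⟨ef.symm.trans eg⟩
  let u : Module.End Λ X := eg.symm.toLinearMap ∘ₗ (LinearEquiv.ofEq _ _ hr).toLinearMap ∘ₗ
    ef.toLinearMap
  obtain ⟨c, hc⟩ := (IsSimpleModule.algebraMap_end_bijective_of_isAlgClosed (A := Λ) (V := X) K).2 u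
  refine ⟨c, ?_⟩
  ext x
  have h1 : g (u x) = f x := by
    have := congrArg Subtype.val (eg.apply_symm_apply (LinearEquiv.ofEq _ _ hr (ef x)))
    exact this
  rw [← h1, ← hc]
  simp [Module.algebraMap_end_apply]
end sq

lemma exists_proj {Λ : Type} [Ring Λ] {T : Type} [AddCommGroup T] [Module Λ T] {m : ℕ}
    (N : Fin m → Submodule Λ T) (h1 : iSupIndep N) (h2 : ⨆ i, N i = ⊤) :
    ∃ ρ : ∀ i, T →ₗ[Λ] N i, (∀ i (x : N i), ρ i x = x) ∧
      (∀ i j, i ≠ j → ∀ x : N j, ρ i x = 0) ∧ ∀ x, ∑ i, (ρ i x : T) = x := by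
  classical
  have hI := DirectSum.isInternal_submodule_of_iSupIndep_of_iSup_eq_top h1 h2
  let E := LinearEquiv.ofBijective (DirectSum.coeLinearMap N) hI
  have hE : ∀ i (x : N i), E.symm x = DirectSum.lof Λ (Fin m) (fun i => N i) i x := by
    intro i x
    rw [LinearEquiv.symm_apply_eq]
    exact (DirectSum.coeLinearMap_lof N i x).symm
  refine ⟨fun i => DirectSum.component Λ (Fin m) (fun i => N i) i ∘ₗ E.symm.toLinearMap, ?_, ?_, ?_⟩
  · intro i x
    simp [hE, DirectSum.component.lof_self]
  · intro i j hij x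
    simp [hE, DirectSum.component.of, hij.symm]
  · intro x
    have : E (E.symm x) = x := E.apply_symm_apply x
    conv_rhs => rw [← this]
    have h3 := DirectSum.coeLinearMap_eq_dfinsuppSum N (E.symm x)
    rw [DFinsupp.sum_eq_sum_fintype _ (fun _ => rfl)] at h3
    exact h3.symm


lemma sum_telescope (n : ℕ) (d : Fin (n + 1) → ℕ) (w : Fin n → ℕ)
    (h : ∀ i, d i.succ = d i.castSucc + w i) : d (Fin.last n) = d 0 + ∑ i, w i := by
  induction n with
  | zero => simp
  | succ n ih =>
    rw [Fin.sum_univ_castSucc, ← add_assoc]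
    have := ih (fun i => d i.castSucc) (fun i => w i.castSucc) (fun i => by
      have := h i.castSucc
      rw [Fin.succ_castSucc] at this
      exact this)
    simp only [Fin.castSucc_zero] at this
    rw [← this, ← h (Fin.last n), Fin.succ_last]

lemma fin_quot {K Λ : Type} [Field K] [Ring Λ] [Algebra K Λ]
    (M : Type) [AddCommGroup M] [Module Λ M] [Module K M] [IsScalarTower K Λ M]
    [FiniteDimensional K M] (N : Submodule Λ M) : FiniteDimensional K (M ⧸ N) :=
  Module.Finite.of_surjective (N.mkQ.restrictScalars K) (Submodule.mkQ_surjective _)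

section main
variable {K Λ : Type} [Field K] [IsAlgClosed K] [Ring Λ] [Algebra K Λ] [FiniteDimensional K Λ]
  (T : Type) [AddCommGroup T] [Module Λ T] [Module K T] [IsScalarTower K Λ T]
    [FiniteDimensional K T] (hss : IsSemisimpleModule Λ T)
    (hsf : ∀ S S' : Submodule Λ T, IsSimpleModule Λ ↥S → IsSimpleModule Λ ↥S' →
        Nonempty (↥S ≃ₗ[Λ] ↥S') → S = S')

lemma mu_eq (hss : IsSemisimpleModule Λ T)
    (hsf : ∀ S S' : Submodule Λ T, IsSimpleModule Λ ↥S → IsSimpleModule Λ ↥S' →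
        Nonempty (↥S ≃ₗ[Λ] ↥S') → S = S')
    (P : Type) [AddCommGroup P] [Module Λ P] [Module K P] [IsScalarTower K Λ P]
    [FiniteDimensional K P] (hproj : Module.Projective Λ P)
    (p : P →ₗ[Λ] T) (hp : Function.Surjective p) (hpk : LinearMap.ker p = jrad Λ P)
    (M : Type) [AddCommGroup M] [Module Λ M] [Module K M] [IsScalarTower K Λ M]
    [FiniteDimensional K M]
    (s : CompositionSeries (Submodule Λ M)) (hs0 : s.head = ⊥) (hs1 : s.last = ⊤) :
    Nat.card {i : Fin s.length //
            ∃ S : Submodule Λ T, IsSimpleModule Λ ↥S ∧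
              Nonempty ((↥(s.toFun i.succ) ⧸
                Submodule.comap (s.toFun i.succ).subtype (s.toFun i.castSucc)) ≃ₗ[Λ] ↥S)} =
      finrank K (P →ₗ[Λ] M) := by
  classical
  have hfs : ∀ N : Submodule Λ M, FiniteDimensional K N := fun N =>
    FiniteDimensional.of_injective (N.subtype.restrictScalars K) (Subtype.val_injective)
  have hstep : ∀ i : Fin s.length, finrank K (P →ₗ[Λ] s.toFun i.succ) =
      finrank K (P →ₗ[Λ] s.toFun i.castSucc) +
      (if (∃ S : Submodule Λ T, IsSimpleModule Λ ↥S ∧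
              Nonempty ((↥(s.toFun i.succ) ⧸
                Submodule.comap (s.toFun i.succ).subtype (s.toFun i.castSucc)) ≃ₗ[Λ] ↥S))
        then 1 else 0) := by
    intro i
    have hle : s.toFun i.castSucc ≤ s.toFun i.succ := (CompositionSeries.lt_succ s i).le
    have hcov : s.toFun i.castSucc ⋖ s.toFun i.succ := s.step i
    have hsim := (covBy_iff_quot_is_simple hle).1 hcov
    have := hfs (s.toFun i.succ)
    have hfq : FiniteDimensional K (↥(s.toFun i.succ) ⧸
                Submodule.comap (s.toFun i.succ).subtype (s.toFun i.castSucc)) :=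
      fin_quot _ _
    rw [← finrank_hom_simple (K := K) T hss hsf]
    rw [finrank_hom_lcomp P T _ p hp]
    · refine hom_exact P _ _ _ (Submodule.inclusion hle) (Submodule.mkQ _)
        (Submodule.inclusion_injective hle) (Submodule.mkQ_surjective _) ?_
      rw [Submodule.ker_mkQ, Submodule.range_inclusion]
    · intro f
      rw [hpk]
      intro x hx
      have h1 := jrad_map f (Submodule.mem_map_of_mem hx)
      rw [jrad_ss] at h1
      exact h1
  have h := sum_telescope s.length (fun k => finrank K (P →ₗ[Λ] s.toFun k)) _ hstep
  have h0 : finrank K (P →ₗ[Λ] s.toFun 0) = 0 := by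
    have hs0 : s.toFun 0 = ⊥ := hs0
    have : Subsingleton (s.toFun 0) := by rw [hs0]; infer_instance
    exact Module.finrank_zero_of_subsingleton
  have h1 : finrank K (P →ₗ[Λ] s.toFun (Fin.last _)) = finrank K (P →ₗ[Λ] M) := by
    have hs1 : s.toFun (Fin.last _) = ⊤ := hs1
    exact finrank_hom_congr P _ _ ((LinearEquiv.ofEq _ _ hs1).trans Submodule.topEquiv)
  simp only [h0, h1, zero_add] at h
  rw [h, Nat.card_eq_fintype_card, Fintype.card_subtype, Finset.card_filter]

lemma back_lift (hss : IsSemisimpleModule Λ T)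
    (hsf : ∀ S S' : Submodule Λ T, IsSimpleModule Λ ↥S → IsSimpleModule Λ ↥S' →
        Nonempty (↥S ≃ₗ[Λ] ↥S') → S = S')
    (M : Type) [AddCommGroup M] [Module Λ M] [Module K M] [IsScalarTower K Λ M]
    [FiniteDimensional K M] (q : M →ₗ[Λ] T) (hqk : LinearMap.ker q = jrad Λ M)
    (m : ℕ) (Q : Fin m → Submodule Λ M) (h1 : iSupIndep Q) (h2 : (⨆ i, Q i) = ⊤)
    (h3 : ∀ i, IsSimpleModule Λ (↥(Q i) ⧸ jrad Λ ↥(Q i))) (g : M →ₗ[Λ] T) :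
    ∃ h : M →ₗ[Λ] M, q ∘ₗ h = g := by
  obtain ⟨ρ, hρ1, hρ2, hρ3⟩ := exists_proj Q h1 h2
  have hk : ∀ i (f : Q i →ₗ[Λ] T), jrad Λ (Q i) ≤ LinearMap.ker f := by
    intro i f x hx
    have h1 := jrad_map f (Submodule.mem_map_of_mem hx)
    rw [jrad_ss] at h1
    exact h1
  have hc : ∀ i, ∃ c : K, ∀ x : Q i, g x = c • q x := by
    intro i
    have := h3 i
    have : FiniteDimensional K (Q i) := FiniteDimensional.of_injective
      ((Q i).subtype.restrictScalars K) (Subtype.val_injective)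
    have : FiniteDimensional K (↥(Q i) ⧸ jrad Λ ↥(Q i)) :=
      fin_quot _ _
    obtain ⟨c, hc⟩ := simple_to_T (K := K) T hsf (↥(Q i) ⧸ jrad Λ ↥(Q i))
      ((jrad Λ ↥(Q i)).liftQ (g ∘ₗ (Q i).subtype) (hk i _))
      ((jrad Λ ↥(Q i)).liftQ (q ∘ₗ (Q i).subtype) (hk i _)) (by
        intro h0
        have hall : ∀ x : Q i, x ∈ jrad Λ (Q i) := by
          intro x
          have hx : q x = 0 := by
            have := LinearMap.congr_fun h0 ((jrad Λ ↥(Q i)).mkQ x)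
            simpa using this
          have hx : (x : M) ∈ jrad Λ M := by rw [← hqk]; exact hx
          have := jrad_map (ρ i) (Submodule.mem_map_of_mem hx)
          rwa [hρ1] at this
        obtain ⟨a, b, hab⟩ := (IsSimpleModule.nontrivial Λ (↥(Q i) ⧸ jrad Λ ↥(Q i))).exists_pair_ne
        apply hab
        obtain ⟨a, rfl⟩ := Submodule.mkQ_surjective _ a
        obtain ⟨b, rfl⟩ := Submodule.mkQ_surjective _ b
        exact (Submodule.Quotient.eq _).2 (hall _))
    refine ⟨c, fun x => ?_⟩
    have := LinearMap.congr_fun hc ((jrad Λ ↥(Q i)).mkQ x)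
    simpa using this
  choose c hc using hc
  refine ⟨∑ i, c i • ((Q i).subtype ∘ₗ ρ i), ?_⟩
  ext x
  have hq : ∀ (k : K) (y : M), q (k • y) = k • q y := fun k y =>
    (q.restrictScalars K).map_smul k y
  conv_rhs => rw [← hρ3 x]
  simp [LinearMap.sum_apply, map_sum, hc, hq]

lemma fwd_decomp (_ : FiniteDimensional K T) (hss : IsSemisimpleModule Λ T)
    (hsf : ∀ S S' : Submodule Λ T, IsSimpleModule Λ ↥S → IsSimpleModule Λ ↥S' →
        Nonempty (↥S ≃ₗ[Λ] ↥S') → S = S')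
    (M : Type) [AddCommGroup M] [Module Λ M] (q : M →ₗ[Λ] T) (hq : Function.Surjective q)
    (hqk : LinearMap.ker q = jrad Λ M)
    (hlift : ∀ g : T →ₗ[Λ] T, ∃ f : M →ₗ[Λ] M, q ∘ₗ f = g ∘ₗ q) :
    ∃ (m : ℕ) (Q : Fin m → Submodule Λ M),
        iSupIndep Q ∧ (⨆ i, Q i) = ⊤ ∧
        ∀ i, IsSimpleModule Λ (↥(Q i) ⧸ jrad Λ ↥(Q i)) := by
  classical
  have : IsNoetherian Λ T := isNoetherian_of_tower K inferInstance
  have : IsArtinianRing Λ := isArtinian_of_tower K inferInstance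
  obtain ⟨m, ⟨eq⟩⟩ := Finite.exists_equiv_fin (isotypicComponents Λ T)
  let N : Fin m → Submodule Λ T := fun i => (eq.symm i).1
  have hN1 : iSupIndep N := ((sSupIndep_iff _).mp (sSupIndep_isotypicComponents Λ T)).comp
    eq.symm.injective
  have hN2 : ⨆ i, N i = ⊤ := by
    rw [← sSup_isotypicComponents Λ T, sSup_eq_iSup']
    exact eq.symm.iSup_comp (g := fun c : isotypicComponents Λ T => c.1)
  have hN3 : ∀ i, IsSimpleModule Λ (N i) := fun i =>
    (finrank_end_T (K := K) T hss hsf).2.le (eq.symm i).2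
  obtain ⟨ρ, hρ1, hρ2, hρ3⟩ := exists_proj N hN1 hN2
  let e : Fin m → Module.End Λ T := fun i => (N i).subtype ∘ₗ ρ i
  have he : CompleteOrthogonalIdempotents e := by
    rw [CompleteOrthogonalIdempotents.iff_ortho_complete]
    constructor
    · intro i j hij
      ext x
      simp [e, hρ2 i j hij]
    · ext x
      simpa [e, LinearMap.sum_apply] using hρ3 x
  have hΦ : ∀ f : Module.End Λ M, ∃ g : Module.End Λ T, g ∘ₗ q = q ∘ₗ f := by
    intro f
    have hle : LinearMap.ker q ≤ LinearMap.ker (q ∘ₗ f) := by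
      intro x hx
      rw [hqk] at hx
      have := jrad_map f (Submodule.mem_map_of_mem hx)
      rw [← hqk] at this
      exact this
    refine ⟨(LinearMap.ker q).liftQ (q ∘ₗ f) hle ∘ₗ
      (q.quotKerEquivOfSurjective hq).symm.toLinearMap, ?_⟩
    ext x
    have : (q.quotKerEquivOfSurjective hq).symm (q x) = (LinearMap.ker q).mkQ x := by
      rw [LinearEquiv.symm_apply_eq]; rfl
    simp [this]
  choose φ hφ using hΦ
  have hφ' : ∀ f x, φ f (q x) = q (f x) := fun f x => LinearMap.congr_fun (hφ f) x
  let Φ : Module.End Λ M →+* Module.End Λ T :=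
    { toFun := φ
      map_one' := by
        refine (LinearMap.cancel_right hq).1 ?_
        ext x; simp [hφ']
      map_mul' := fun a b => by
        refine (LinearMap.cancel_right hq).1 ?_
        ext x; simp [hφ']
      map_zero' := by
        refine (LinearMap.cancel_right hq).1 ?_
        ext x; simp [hφ']
      map_add' := fun a b => by
        refine (LinearMap.cancel_right hq).1 ?_
        ext x; simp [hφ'] }
  have hΦ : ∀ f x, Φ f (q x) = q (f x) := hφ'
  obtain ⟨e', he', hee⟩ := CompleteOrthogonalIdempotents.lift_of_isNilpotent_ker Φ (by
      intro f hf
      refine nilp_of_range f fun x => ?_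
      rw [← hqk, LinearMap.mem_ker, ← hΦ, (RingHom.mem_ker).1 hf]
      rfl) he (by
      intro i
      obtain ⟨f, hf⟩ := hlift (e i)
      refine ⟨f, (LinearMap.cancel_right hq).1 ?_⟩
      rw [← hf]
      ext x
      exact hΦ f x)
  have hqe : ∀ i x, q (e' i x) = e i (q x) := by
    intro i x
    rw [← hee, Function.comp_apply, hΦ]
  have hidem : ∀ i x, e' i (e' i x) = e' i x := fun i x => LinearMap.congr_fun (he'.idem i) x
  have horth : ∀ i j, i ≠ j → ∀ x, e' i (e' j x) = 0 := fun i j hij x =>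
    LinearMap.congr_fun (he'.ortho hij) x
  refine ⟨m, fun i => LinearMap.range (e' i), ?_, ?_, ?_⟩
  · intro i
    rw [Submodule.disjoint_def]
    rintro _ ⟨x, rfl⟩ hx2
    have hle : ⨆ j, ⨆ (_ : j ≠ i), LinearMap.range (e' j) ≤ LinearMap.ker (e' i) := by
      refine iSup₂_le fun j hj => ?_
      rintro _ ⟨y, rfl⟩
      exact horth i j hj.symm y
    have := hle hx2
    rw [← hidem]
    exact this
  · rw [eq_top_iff]
    intro x _
    have hx : ∑ i, e' i x = x := by
      have := LinearMap.congr_fun he'.complete x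
      simpa [LinearMap.sum_apply] using this
    rw [← hx]
    exact Submodule.sum_mem _ fun i _ => Submodule.mem_iSup_of_mem i ⟨x, rfl⟩
  · intro i
    let r : LinearMap.range (e' i) →ₗ[Λ] T := q ∘ₗ (LinearMap.range (e' i)).subtype
    have hker : LinearMap.ker r = jrad Λ (LinearMap.range (e' i)) := by
      apply le_antisymm
      · intro x hx
        have hx : (x : M) ∈ jrad Λ M := by rw [← hqk]; exact hx
        have h := jrad_map (e' i).rangeRestrict (Submodule.mem_map_of_mem hx)
        have hxx : (e' i).rangeRestrict x = x := by
          obtain ⟨_, y, rfl⟩ := x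
          exact Subtype.ext (hidem i y)
        rwa [hxx] at h
      · intro x hx
        have h1 := jrad_map r (Submodule.mem_map_of_mem hx)
        rw [jrad_ss] at h1
        exact h1
    have hrange : LinearMap.range r = N i := by
      ext y
      constructor
      · rintro ⟨⟨_, x, rfl⟩, rfl⟩
        change q (e' i x) ∈ N i
        rw [hqe]
        exact (ρ i (q x)).2
      · intro hy
        obtain ⟨x, rfl⟩ := hq y
        refine ⟨⟨e' i x, x, rfl⟩, ?_⟩
        change q (e' i x) = q x
        rw [hqe]
        exact congrArg Subtype.val (hρ1 i ⟨q x, hy⟩)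
    rw [← hker]
    have := hN3 i
    exact IsSimpleModule.congr (r.quotKerEquivRange.trans (LinearEquiv.ofEq _ _ hrange))
end main

/-- Let `T` be a squarefree semisimple `Λ`-module with exactly `t` simple
direct summands, `P` a projective cover of `T`, `C ⊆ JP` a submodule and `M = P/C`.  Then `C`
is invariant under every `Λ`-endomorphism of `P` if and only if `M` is a direct sum of local
modules and `μ_T(M) = t + dim_K Hom_Λ(M, JM)`, where `μ_T(M)` is the number of composition
factors of `M` isomorphic to a simple direct summand of `T`. -/
theorem stmt6 {K Λ : Type} [Field K] [IsAlgClosed K] [Ring Λ] [Algebra K Λ]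
    [FiniteDimensional K Λ]
    (T : Type) [AddCommGroup T] [Module Λ T] [Module K T] [IsScalarTower K Λ T]
    [FiniteDimensional K T]
    (P : Type) [AddCommGroup P] [Module Λ P] [Module K P] [IsScalarTower K Λ P]
    [SMulCommClass Λ K P] [FiniteDimensional K P]
    -- `T` is semisimple and squarefree:
    (hss : IsSemisimpleModule Λ T)
    (hsf : ∀ S S' : Submodule Λ T, IsSimpleModule Λ ↥S → IsSimpleModule Λ ↥S' →
        Nonempty (↥S ≃ₗ[Λ] ↥S') → S = S')
    -- `T` has exactly `t` simple direct summands (for squarefree semisimple `T` these are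
    -- exactly the simple submodules of `T`):
    (t : ℕ) (ht : Nat.card {S : Submodule Λ T // IsSimpleModule Λ ↥S} = t)
    -- `P` is a projective cover of `T`:
    (hproj : Module.Projective Λ P)
    (hcover : Nonempty ((P ⧸ jrad Λ P) ≃ₗ[Λ] T))
    (C : Submodule Λ P) (hC : C ≤ jrad Λ P) :
    -- `C` is invariant under every `Λ`-endomorphism of `P` ...
    (∀ f : P →ₗ[Λ] P, C.map f ≤ C)
    ↔
    -- ... iff `M = P/C` is a direct sum of local modules (modules with simple top) ...
    ((∃ (m : ℕ) (Q : Fin m → Submodule Λ (P ⧸ C)),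
        iSupIndep Q ∧ (⨆ i, Q i) = ⊤ ∧
        ∀ i, IsSimpleModule Λ (↥(Q i) ⧸ jrad Λ ↥(Q i))) ∧
    -- ... and `μ_T(M) = t + dim_K Hom_Λ(M, JM)`, where `μ_T(M)` is computed as the number of
    -- factors of any composition series of `M` isomorphic to a simple direct summand of `T`:
      (∀ s : CompositionSeries (Submodule Λ (P ⧸ C)), s.head = ⊥ → s.last = ⊤ →
        Nat.card {i : Fin s.length //
            ∃ S : Submodule Λ T, IsSimpleModule Λ ↥S ∧
              Nonempty ((↥(s.toFun i.succ) ⧸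
                Submodule.comap (s.toFun i.succ).subtype (s.toFun i.castSucc)) ≃ₗ[Λ] ↥S)} =
          t + finrank K ((P ⧸ C) →ₗ[Λ] ↥(jrad Λ (P ⧸ C))))) := by
  obtain ⟨E⟩ := hcover
  let p : P →ₗ[Λ] T := E.toLinearMap ∘ₗ (jrad Λ P).mkQ
  have hp : Function.Surjective p := E.surjective.comp (Submodule.mkQ_surjective _)
  have hpk : LinearMap.ker p = jrad Λ P := by
    rw [LinearEquiv.ker_comp, Submodule.ker_mkQ]
  let q : (P ⧸ C) →ₗ[Λ] T := C.liftQ p (hpk ▸ hC)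
  have hqp : ∀ x, q (C.mkQ x) = p x := fun x => rfl
  have hq : Function.Surjective q := fun y => by
    obtain ⟨x, rfl⟩ := hp y
    exact ⟨C.mkQ x, rfl⟩
  have hqk : LinearMap.ker q = jrad Λ (P ⧸ C) := by
    rw [← jrad_map_surj C.mkQ (Submodule.mkQ_surjective _), ← hpk]
    exact Submodule.ker_liftQ _ _ _
  have hfq : FiniteDimensional K (P ⧸ C) :=
    Module.Finite.of_surjective (C.mkQ.restrictScalars K) (Submodule.mkQ_surjective _)
  have hfj : FiniteDimensional K (jrad Λ (P ⧸ C)) := FiniteDimensional.of_injective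
    ((jrad Λ (P ⧸ C)).subtype.restrictScalars K) (Subtype.val_injective)
  have hkillT : ∀ f : P →ₗ[Λ] T, jrad Λ P ≤ LinearMap.ker f := by
    intro f x hx
    have h1 := jrad_map f (Submodule.mem_map_of_mem hx)
    rw [jrad_ss] at h1
    exact h1
  have hPT : finrank K (P →ₗ[Λ] T) = t := by
    rw [← ht, ← (finrank_end_T (K := K) T hss hsf).1]
    exact (finrank_hom_lcomp P T T p hp (fun f => hpk ▸ hkillT f)).symm
  have hdim : finrank K (P →ₗ[Λ] (P ⧸ C)) =
      t + finrank K (P →ₗ[Λ] jrad Λ (P ⧸ C)) := by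
    rw [hom_exact (K := K) P _ (P ⧸ C) T (jrad Λ (P ⧸ C)).subtype q (Submodule.subtype_injective _) hq
      (by rw [Submodule.range_subtype, hqk]), hPT, add_comm]
  have hmu := mu_eq (K := K) T hss hsf P hproj p hp hpk (P ⧸ C)
  constructor
  · intro hinv
    -- every map from P to P/C kills C
    have hkill : ∀ f : P →ₗ[Λ] (P ⧸ C), C ≤ LinearMap.ker f := by
      intro f x hx
      obtain ⟨g, rfl⟩ := Module.projective_lifting_property C.mkQ f (Submodule.mkQ_surjective _)
      have := hinv g (Submodule.mem_map_of_mem hx)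
      simpa using this
    constructor
    · refine fwd_decomp (K := K) T inferInstance hss hsf (P ⧸ C) q hq hqk ?_
      intro g
      obtain ⟨f, hf⟩ := Module.projective_lifting_property q (g ∘ₗ p) hq
      refine ⟨C.liftQ f (hkill f), ?_⟩
      refine (LinearMap.cancel_right (Submodule.mkQ_surjective C)).1 ?_
      ext x
      exact LinearMap.congr_fun hf x
    · intro s hs0 hs1
      rw [hmu s hs0 hs1, hdim, finrank_hom_lcomp P (P ⧸ C) _ C.mkQ (Submodule.mkQ_surjective _)]
      intro f x hx
      rw [Submodule.ker_mkQ] at hx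
      have := hkill ((jrad Λ (P ⧸ C)).subtype ∘ₗ f) hx
      exact Subtype.ext this
  · rintro ⟨⟨m, Q, h1, h2, h3⟩, hcount⟩ f
    have : IsNoetherian Λ (P ⧸ C) := isNoetherian_of_tower K inferInstance
    have : IsArtinian Λ (P ⧸ C) := isArtinian_of_tower K inferInstance
    obtain ⟨s, hs0, hs1⟩ := exists_compositionSeries_of_isNoetherian_isArtinian Λ (P ⧸ C)
    have hc := hcount s hs0 hs1
    rw [hmu s hs0 hs1, hdim] at hc
    have hkill := lcomp_kills (K := K) P (P ⧸ C) (jrad Λ (P ⧸ C)) C.mkQ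
      (Submodule.mkQ_surjective _) (by omega)
    obtain ⟨h, hh⟩ := back_lift (K := K) T hss hsf (P ⧸ C) q hqk m Q h1 h2 h3
      (C.liftQ (p ∘ₗ f) (hC.trans (hkillT _)))
    have hmem : ∀ x, (C.mkQ ∘ₗ f - h ∘ₗ C.mkQ) x ∈ jrad Λ (P ⧸ C) := by
      intro x
      rw [← hqk, LinearMap.mem_ker, LinearMap.sub_apply, map_sub, sub_eq_zero]
      exact (LinearMap.congr_fun hh (C.mkQ x)).symm
    rintro _ ⟨x, hx, rfl⟩
    have h0 := hkill (LinearMap.codRestrict _ _ hmem) (by rw [Submodule.ker_mkQ]; exact hx)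
    have h0' : C.mkQ (f x) - h (C.mkQ x) = 0 := congrArg Subtype.val h0
    have hx0 : C.mkQ x = 0 := by
      rw [← LinearMap.mem_ker, Submodule.ker_mkQ]; exact hx
    rw [hx0, map_zero, sub_zero, ← LinearMap.mem_ker, Submodule.ker_mkQ] at h0'
    exact h0'
end
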